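/- Let d ≥ 2 and q = 2(d+1)/(d−1). There exists a constant C > 0 (depending only on d) such that for all Schwartz functions f, g on ℝ^d, the solution of the free wave equation u(t,x) = ∫_{ℝ^d} e^{i t|ξ| + i x·ξ} γ₊(ξ) dξ + ∫_{ℝ^d} e^{−i t|ξ| + i x·ξ} γ₋(ξ) dξ, where γ_±(ξ) = (1/2)( f̂(ξ) ± ĝ(ξ)/(i|ξ|) ), satisfies ‖u‖_{L^{q}(ℝ_t × ℝ^d_x)} ≤ C ( ‖f‖_{Ḣ^{1/2}} + ‖g‖_{Ḣ^{−1/2}} ). -/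

import Mathlib

open MeasureTheory Complex
open scoped ENNReal RealInnerProductSpace

noncomputable section

/-- Fourier transform `f̂(ξ) = ∫ e^{-i x·ξ} f(x) dx` on `ℝⁿ`. -/
def fourierTf {n : ℕ} (f : EuclideanSpace ℝ (Fin n) → ℂ) (ξ : EuclideanSpace ℝ (Fin n)) : ℂ :=
  ∫ x : EuclideanSpace ℝ (Fin n), Complex.exp (-Complex.I * Complex.ofReal ⟪x, ξ⟫) * f x

/-- Homogeneous Sobolev norm `‖f‖_{Ḣˢ}` on `ℝⁿ`. -/
def sobolevNorm {n : ℕ} (s : ℝ) (f : EuclideanSpace ℝ (Fin n) → ℂ) : ℝ :=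
  (∫ ξ : EuclideanSpace ℝ (Fin n), ‖ξ‖ ^ (2 * s) * ‖fourierTf f ξ‖ ^ 2) ^ (1 / 2 : ℝ)

lemma sw_osc_low (y : ℝ) (hy : y ≠ 0) (a b ρ : ℝ) (ha : 0 < a) (hab : a ≤ b) (hb : b * |ρ| ≤ 1) :
    ‖∫ s in a..b, (s : ℂ) ^ (-1 + I * y) * cexp (I * (ρ * s : ℝ))‖ ≤ 2 / |y| + 1 := by
  have hpos : ∀ s ∈ Set.uIcc a b, 0 < s := fun s hs => by
    rw [Set.uIcc_of_le hab] at hs; exact ha.trans_le hs.1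
  have hc1 : ContinuousOn (fun s : ℝ => (s : ℂ) ^ (-1 + I * y)) (Set.uIcc a b) := by
    intro s hs
    exact (continuousAt_ofReal_cpow_const s _ (Or.inr (hpos s hs).ne')).continuousWithinAt
  have hc2 : ContinuousOn (fun s : ℝ => (s : ℂ) ^ (-1 + I * y) * (cexp (I * (ρ * s : ℝ)) - 1))
      (Set.uIcc a b) := hc1.mul (by fun_prop)
  have hsplit : (∫ s in a..b, (s : ℂ) ^ (-1 + I * y) * cexp (I * (ρ * s : ℝ))) =
      (∫ s in a..b, (s : ℂ) ^ (-1 + I * y)) +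
        ∫ s in a..b, (s : ℂ) ^ (-1 + I * y) * (cexp (I * (ρ * s : ℝ)) - 1) := by
    rw [← intervalIntegral.integral_add hc1.intervalIntegrable hc2.intervalIntegrable]
    congr 1; ext s; ring
  rw [hsplit]
  refine (norm_add_le _ _).trans (add_le_add ?_ ?_)
  · rw [integral_cpow]
    · have hy' : (-1 + I * (y:ℂ) + 1) = I * y := by ring
      rw [hy', norm_div]
      have : ‖I * (y:ℂ)‖ = |y| := by simp
      rw [this]
      gcongr
      refine (norm_sub_le _ _).trans ?_
      rw [norm_cpow_eq_rpow_re_of_pos (ha.trans_le hab), norm_cpow_eq_rpow_re_of_pos ha]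
      simp; norm_num
    · right
      refine ⟨?_, ?_⟩
      · intro h
        apply hy
        have := congrArg Complex.im h
        simpa using this
      · intro h; exact (lt_irrefl _ (hpos 0 h))
  · have : ∀ s ∈ Set.uIoc a b, ‖(s : ℂ) ^ (-1 + I * y) * (cexp (I * (ρ * s : ℝ)) - 1)‖ ≤ |ρ| := by
      intro s hs
      rw [Set.uIoc_of_le hab] at hs
      have hs0 : 0 < s := ha.trans hs.1
      rw [norm_mul, norm_cpow_eq_rpow_re_of_pos hs0]
      have h1 : ‖cexp (I * (ρ * s : ℝ)) - 1‖ ≤ |ρ| * s := by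
        have := Real.norm_exp_I_mul_ofReal_sub_one_le (x := ρ * s)
        simpa [abs_mul, abs_of_pos hs0] using this
      have h2 : s ^ (-1 + I * (y:ℂ)).re = s⁻¹ := by simp [Real.rpow_neg_one]
      rw [h2]
      calc s⁻¹ * _ ≤ s⁻¹ * (|ρ| * s) := by gcongr
        _ = |ρ| := by field_simp
    refine (intervalIntegral.norm_integral_le_of_norm_le_const this).trans ?_
    rw [abs_of_nonneg (sub_nonneg.2 hab)]
    nlinarith [abs_nonneg ρ]

lemma sw_osc_high (y : ℝ) (a b ρ : ℝ) (ha : 0 < a) (hab : a ≤ b) (hb : 1 ≤ a * |ρ|) :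
    ‖∫ s in a..b, (s : ℂ) ^ (-1 + I * y) * cexp (I * (ρ * s : ℝ))‖ ≤ 3 + |y| := by
  have hb0 : 0 < b := ha.trans_le hab
  have hρ0 : 0 < |ρ| := by
    rcases (abs_nonneg ρ).eq_or_lt with h | h
    · rw [← h] at hb; simp at hb; linarith
    · exact h
  have hρ : ρ ≠ 0 := abs_pos.1 hρ0
  have hρc : (ρ : ℂ) ≠ 0 := by exact_mod_cast hρ
  have hpos : ∀ s ∈ Set.uIcc a b, 0 < s := fun s hs => by
    rw [Set.uIcc_of_le hab] at hs; exact ha.trans_le hs.1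
  have hcc : ∀ c : ℂ, ContinuousOn (fun s : ℝ => (s : ℂ) ^ c) (Set.uIcc a b) := by
    intro c s hs
    exact (continuousAt_ofReal_cpow_const s _ (Or.inr (hpos s hs).ne')).continuousWithinAt
  have hu : ∀ s ∈ Set.uIcc a b, HasDerivAt (fun s : ℝ => (s : ℂ) ^ (-1 + I * (y:ℂ)))
      ((-1 + I * (y:ℂ)) * (s : ℂ) ^ (-2 + I * (y:ℂ))) s := by
    intro s hs
    have h0 : HasDerivAt (fun z : ℂ => z ^ (-1 + I * (y:ℂ)))
        ((-1 + I * (y:ℂ)) * (s : ℂ) ^ (-1 + I * (y:ℂ) - 1)) (s : ℂ) := by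
      have := (hasDerivAt_id (s : ℂ)).cpow_const (c := -1 + I * (y:ℂ))
        (Or.inl (by simpa using hpos s hs))
      simpa using this
    have := h0.comp_ofReal
    convert this using 3
    ring
  have hv : ∀ s ∈ Set.uIcc a b, HasDerivAt (fun s : ℝ => cexp (I * (ρ * s : ℝ)) / (I * ρ))
      (cexp (I * (ρ * s : ℝ))) s := by
    intro s hs
    have h0 : HasDerivAt (fun z : ℂ => cexp (I * (ρ * z)) / (I * ρ)) (cexp (I * (ρ * s))) (s : ℂ) := by
      have h1 : HasDerivAt (fun z : ℂ => I * (ρ * z)) (I * ρ) (s : ℂ) := by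
        have := ((hasDerivAt_id (s:ℂ)).const_mul (ρ:ℂ)).const_mul I
        simpa using this
      have := h1.cexp.div_const (I * (ρ:ℂ))
      rwa [mul_div_assoc, div_self (mul_ne_zero I_ne_zero hρc), mul_one] at this
    simpa using h0.comp_ofReal
  have hib := intervalIntegral.integral_mul_deriv_eq_deriv_mul hu hv
    ((continuousOn_const.mul (hcc _)).intervalIntegrable)
    ((by fun_prop : Continuous fun s : ℝ => cexp (I * (ρ * s : ℝ))).intervalIntegrable _ _)
  rw [hib]
  have hn : ∀ s : ℝ, ‖cexp (I * (ρ * s : ℝ)) / (I * ρ)‖ = |ρ|⁻¹ := by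
    intro s
    rw [norm_div, mul_comm I, norm_exp_ofReal_mul_I]; simp
  have hB : ∀ s : ℝ, a ≤ s → ‖(s : ℂ) ^ (-1 + I * (y:ℂ)) * (cexp (I * (ρ * s : ℝ)) / (I * ρ))‖ ≤ 1 := by
    intro s hs
    rw [norm_mul, hn, norm_cpow_eq_rpow_re_of_pos (ha.trans_le hs)]
    have h2 : s ^ (-1 + I * (y:ℂ)).re = s⁻¹ := by simp [Real.rpow_neg_one]
    rw [h2, ← mul_inv]
    apply inv_le_one_of_one_le₀
    nlinarith
  have h3 : ‖∫ s in a..b, ((-1 + I * (y:ℂ)) * (s : ℂ) ^ (-2 + I * (y:ℂ))) *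
      (cexp (I * (ρ * s : ℝ)) / (I * ρ))‖ ≤ 1 + |y| := by
    have hle : ‖∫ s in a..b, ((-1 + I * (y:ℂ)) * (s : ℂ) ^ (-2 + I * (y:ℂ))) *
      (cexp (I * (ρ * s : ℝ)) / (I * ρ))‖ ≤ ∫ s in a..b, ((1 + |y|) * |ρ|⁻¹) * s ^ (-2 : ℝ) := by
      apply intervalIntegral.norm_integral_le_of_norm_le hab
      · filter_upwards with s hs
        have hs0 : 0 < s := ha.trans hs.1
        rw [norm_mul, norm_mul, hn, norm_cpow_eq_rpow_re_of_pos hs0]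
        have h2 : (-2 + I * (y:ℂ)).re = -2 := by simp
        rw [h2]
        have : ‖-1 + I * (y:ℂ)‖ ≤ 1 + |y| := by
          refine (norm_add_le _ _).trans ?_; simp
        calc _ ≤ (1 + |y|) * s ^ (-2:ℝ) * |ρ|⁻¹ := by gcongr
          _ = _ := by ring
      · apply ContinuousOn.intervalIntegrable
        apply continuousOn_const.mul
        intro s hs
        exact (Real.continuousAt_rpow_const _ _ (Or.inl (hpos s hs).ne')).continuousWithinAt
    refine hle.trans ?_
    rw [intervalIntegral.integral_const_mul, integral_rpow (by
      right; exact ⟨by norm_num, fun h => lt_irrefl _ (hpos 0 h)⟩)]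
    norm_num [Real.rpow_neg_one]
    have : |ρ|⁻¹ * (a⁻¹ - b⁻¹) ≤ 1 := by
      have h1 : |ρ|⁻¹ * a⁻¹ ≤ 1 := by
        rw [← mul_inv]; apply inv_le_one_of_one_le₀; linarith
      have h2 : 0 ≤ |ρ|⁻¹ * b⁻¹ := by positivity
      nlinarith
    have h1y : 0 ≤ 1 + |y| := by positivity
    calc _ = (1 + |y|) * (|ρ|⁻¹ * (a⁻¹ - b⁻¹)) := by ring
      _ ≤ (1 + |y|) * 1 := by gcongr
      _ = _ := by ring
  calc _ ≤ (1 + 1) + (1 + |y|) := by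
        refine (norm_sub_le _ _).trans (add_le_add ((norm_sub_le _ _).trans
          (add_le_add (hB b hab) (hB a le_rfl))) h3)
    _ = _ := by ring

lemma sw_osc (y : ℝ) (hy : y ≠ 0) (a b ρ : ℝ) (ha : 0 < a) (hab : a ≤ b) :
    ‖∫ s in a..b, (s : ℂ) ^ (-1 + I * y) * cexp (I * (ρ * s : ℝ))‖ ≤ 2 / |y| + 4 + |y| := by
  have hy0 : 0 ≤ 2 / |y| := by positivity
  have hyy := abs_nonneg y
  by_cases h1 : b * |ρ| ≤ 1
  · exact (sw_osc_low y hy a b ρ ha hab h1).trans (by linarith)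
  by_cases h2 : 1 ≤ a * |ρ|
  · exact (sw_osc_high y a b ρ ha hab h2).trans (by linarith)
  push Not at h1 h2
  have hρ0 : 0 < |ρ| := by
    rcases (abs_nonneg ρ).eq_or_lt with h | h
    · rw [← h] at h1; simp at h1; linarith
    · exact h
  have hac : a ≤ |ρ|⁻¹ := by rw [le_inv_comm₀ ha hρ0, ← one_div, le_div_iff₀ ha]; linarith
  have hcb : |ρ|⁻¹ ≤ b := by rw [inv_le_comm₀ hρ0 (by linarith), ← one_div, div_le_iff₀ (by linarith)]; linarith
  have hint : ∀ a' b', 0 < a' → a' ≤ b' → IntervalIntegrable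
      (fun s : ℝ => (s : ℂ) ^ (-1 + I * (y:ℂ)) * cexp (I * (ρ * s : ℝ))) volume a' b' := by
    intro a' b' h0 h1
    apply ContinuousOn.intervalIntegrable
    refine ContinuousOn.mul ?_ (by fun_prop)
    intro s hs
    rw [Set.uIcc_of_le h1] at hs
    exact (continuousAt_ofReal_cpow_const s _ (Or.inr (h0.trans_le hs.1).ne')).continuousWithinAt
  rw [← intervalIntegral.integral_add_adjacent_intervals (hint a _ ha hac)
    (hint _ b (inv_pos.2 hρ0) hcb)]
  refine (norm_add_le _ _).trans ?_
  have e1 := sw_osc_low y hy a _ ρ ha hac (by rw [inv_mul_cancel₀ hρ0.ne'])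
  have e2 := sw_osc_high y _ b ρ (inv_pos.2 hρ0) hcb (by rw [inv_mul_cancel₀ hρ0.ne'])
  linarith

lemma sw_osc_inv (y : ℝ) (hy : y ≠ 0) (a b ρ : ℝ) (ha : 0 < a) (hab : a ≤ b) :
    ‖∫ s in a..b, (s : ℂ) ^ (-1 + I * y) * cexp (I * (ρ / s : ℝ))‖ ≤ 2 / |y| + 4 + |y| := by
  have hb0 : 0 < b := ha.trans_le hab
  have hpos : ∀ s ∈ Set.uIcc a b, 0 < s := fun s hs => by
    rw [Set.uIcc_of_le hab] at hs; exact ha.trans_le hs.1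
  have hsub := intervalIntegral.integral_deriv_smul_comp'' (a := a) (b := b)
    (f := fun s : ℝ => s⁻¹) (f' := fun s : ℝ => -(s^2)⁻¹)
    (g := fun r : ℝ => (r : ℂ) ^ (-1 + I * ((-y : ℝ) : ℂ)) * cexp (I * (ρ * r : ℝ))) ?_ ?_ ?_ ?_
  · have := sw_osc (-y) (by simpa using hy) b⁻¹ a⁻¹ ρ (by positivity) (by gcongr)
    rw [intervalIntegral.integral_symm, norm_neg, ← hsub, ← norm_neg,
      ← intervalIntegral.integral_neg] at this
    simp only [abs_neg] at this
    refine le_trans (le_of_eq (congrArg norm ?_)) this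
    apply intervalIntegral.integral_congr
    intro s hs
    have hs0 := hpos s hs
    simp only [Function.comp, real_smul]
    rw [div_eq_mul_inv]
    have hsc : (s:ℂ) ≠ 0 := by exact_mod_cast hs0.ne'
    have e : (s : ℂ) ^ (-1 + I * (y:ℂ)) = ((s^2)⁻¹ : ℝ) * ((s⁻¹ : ℝ) : ℂ) ^ (-1 + I * ((-y : ℝ) : ℂ)) := by
      rw [ofReal_inv s, inv_cpow _ _ (by rw [arg_ofReal_of_nonneg hs0.le]; exact Real.pi_pos.ne),
        ← cpow_neg]
      have : (((s^2)⁻¹ : ℝ) : ℂ) = (s:ℂ) ^ (-2 : ℂ) := by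
        rw [cpow_neg]; push_cast; congr 1; norm_cast
      rw [this, ← cpow_add _ _ hsc]
      congr 1; push_cast; ring
    rw [e]; push_cast; ring
  · exact fun s hs => (continuousAt_inv₀ (hpos s hs).ne').continuousWithinAt
  · intro s hs
    have : 0 < s := by
      rw [min_eq_left hab] at hs; exact ha.trans hs.1
    exact (hasDerivAt_inv this.ne').hasDerivWithinAt
  · intro s hs
    have := (hpos s hs).ne'
    exact ((continuousAt_id.pow 2).inv₀ (by simpa using this)).neg.continuousWithinAt
  · refine ContinuousOn.mul ?_ (by fun_prop)
    rintro r ⟨s, hs, rfl⟩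
    exact (continuousAt_ofReal_cpow_const _ _ (Or.inr (inv_pos.2 (hpos s hs)).ne')).continuousWithinAt

/-- Space-time. -/
abbrev SwE (d : ℕ) := ℝ × EuclideanSpace ℝ (Fin d)

instance swHaar (d : ℕ) : (volume : Measure (SwE d)).IsAddHaarMeasure :=
  inferInstanceAs ((volume : Measure ℝ).prod (volume : Measure (EuclideanSpace ℝ (Fin d)))).IsAddHaarMeasure

def swPr {d : ℕ} (p k : SwE d) : ℝ := p.1 * k.1 + ⟪p.2, k.2⟫

def swFT {d : ℕ} (F : SwE d → ℂ) (k : SwE d) : ℂ := ∫ p : SwE d, cexp (I * (swPr p k : ℝ)) * F p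

def swK {d : ℕ} (b c : ℂ) (q : SwE d) : ℂ :=
  (((Real.pi : ℂ) / b) ^ (1 / 2 : ℂ) * cexp (-(‖q.1‖ : ℂ) ^ 2 / (4 * b))) *
    (((Real.pi : ℂ) / c) ^ ((d : ℂ) / 2) * cexp (-(‖q.2‖ : ℂ) ^ 2 / (4 * c)))

def swM {d : ℕ} (b c : ℂ) (k : SwE d) : ℂ :=
  cexp (-b * (‖k.1‖ : ℂ) ^ 2) * cexp (-c * (‖k.2‖ : ℂ) ^ 2)

lemma swPr_cont {d : ℕ} : Continuous (fun z : SwE d × SwE d => swPr z.1 z.2) := by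
  unfold swPr; fun_prop

@[fun_prop]
lemma swPr_cont' {d : ℕ} {X : Type*} [TopologicalSpace X] {f g : X → SwE d} (hf : Continuous f)
    (hg : Continuous g) : Continuous (fun x => swPr (f x) (g x)) :=
  swPr_cont.comp (hf.prodMk hg)

@[fun_prop]
lemma swM_cont {d : ℕ} (b c : ℂ) : Continuous (swM (d := d) b c) := by
  unfold swM; fun_prop

@[fun_prop]
lemma swK_cont {d : ℕ} (b c : ℂ) : Continuous (swK (d := d) b c) := by
  unfold swK; fun_prop

lemma sw_norm_exp (x : ℝ) : ‖cexp (I * (x : ℂ))‖ = 1 := by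
  rw [mul_comm, norm_exp_ofReal_mul_I]

lemma sw_enorm_exp (x : ℝ) : ‖cexp (I * (x : ℂ))‖ₑ = 1 := by
  rw [← ofReal_norm, sw_norm_exp]; simp

lemma sw_int_phase {X : Type*} [MeasurableSpace X] {μ : Measure X} {F : X → ℂ} (hF : Integrable F μ)
    {φ : X → ℝ} (hφ : AEStronglyMeasurable φ μ) :
    Integrable (fun x => cexp (I * (φ x : ℂ)) * F x) μ := by
  refine hF.bdd_mul (c := 1) ?_ (Filter.Eventually.of_forall fun x => (sw_norm_exp _).le)
  exact (by fun_prop : Continuous fun y : ℝ => cexp (I * (y : ℂ))).comp_aestronglyMeasurable hφ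

lemma swM_integrable {d : ℕ} {b c : ℂ} (hb : 0 < b.re) (hc : 0 < c.re) :
    Integrable (swM (d := d) b c) := by
  have h1 := GaussianFourier.integrable_cexp_neg_mul_sq_norm_add hb 0 (0 : ℝ)
  have h2 := GaussianFourier.integrable_cexp_neg_mul_sq_norm_add hc 0 (0 : EuclideanSpace ℝ (Fin d))
  simp only [zero_mul, add_zero] at h1 h2
  exact h1.mul_prod h2

lemma swM_fourier {d : ℕ} {b c : ℂ} (hb : 0 < b.re) (hc : 0 < c.re) (q : SwE d) :
    ∫ k, swM b c k * cexp (I * (swPr q k : ℝ)) = swK b c q := by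
  have h1 := GaussianFourier.integral_cexp_neg_mul_sq_norm_add hb I q.1
  have h2 := GaussianFourier.integral_cexp_neg_mul_sq_norm_add hc I q.2
  have e1 : swK b c q = (∫ v : ℝ, cexp (-b * ‖v‖ ^ 2 + I * ⟪q.1, v⟫)) *
      ∫ v : EuclideanSpace ℝ (Fin d), cexp (-c * ‖v‖ ^ 2 + I * ⟪q.2, v⟫) := by
    rw [h1, h2]; simp [swK]
  rw [e1, ← integral_prod_mul]
  apply integral_congr_ae
  filter_upwards with k
  simp only [swM, swPr, ← Complex.exp_add]
  congr 1
  simp only [RCLike.inner_apply, conj_trivial]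
  push_cast
  rw [real_inner_comm]
  ring

lemma swFT_mul {d : ℕ} (F G : SwE d → ℂ) (k : SwE d) :
    swFT F k * swFT G (-k) = ∫ z : SwE d × SwE d, cexp (I * (swPr (z.1 - z.2) k : ℝ)) *
      (F z.1 * G z.2) := by
  unfold swFT
  rw [← integral_prod_mul]
  apply integral_congr_ae
  filter_upwards with z
  have : cexp (I * (swPr (z.1 - z.2) k : ℝ)) = cexp (I * (swPr z.1 k : ℝ)) *
      cexp (I * (swPr z.2 (-k) : ℝ)) := by
    rw [← Complex.exp_add]; congr 1
    simp only [swPr, Prod.fst_sub, Prod.snd_sub, Prod.fst_neg, Prod.snd_neg, inner_sub_left,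
      inner_neg_right]
    push_cast; ring
  rw [this]; ring

lemma sw_gauss_form {d : ℕ} {b c : ℂ} (hb : 0 < b.re) (hc : 0 < c.re) {F G : SwE d → ℂ}
    (hF : Integrable F) (hG : Integrable G) :
    ∫ k, swM b c k * (swFT F k * swFT G (-k)) =
      ∫ z : SwE d × SwE d, F z.1 * G z.2 * swK b c (z.1 - z.2) := by
  simp_rw [swFT_mul, ← swM_fourier hb hc, ← integral_const_mul]
  rw [integral_integral_swap]
  · apply integral_congr_ae
    filter_upwards with z
    apply integral_congr_ae
    filter_upwards with k
    ring
  · have h : Integrable (fun w : SwE d × (SwE d × SwE d) => swM b c w.1 * (F w.2.1 * G w.2.2))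
        (volume.prod volume) := (swM_integrable hb hc).mul_prod (hF.mul_prod hG)
    have := sw_int_phase h (φ := fun w => swPr (w.2.1 - w.2.2) w.1)
      (by apply Continuous.aestronglyMeasurable; fun_prop)
    refine this.congr ?_
    filter_upwards with w
    simp only [Function.uncurry]
    ring

lemma swFT_cont {d : ℕ} {F : SwE d → ℂ} (hF : Integrable F) : Continuous (swFT F) := by
  unfold swFT
  refine continuous_of_dominated (bound := fun p => ‖F p‖) ?_ ?_ hF.norm ?_
  · intro k
    exact (sw_int_phase hF (by apply Continuous.aestronglyMeasurable; fun_prop)).aestronglyMeasurable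
  · intro k; filter_upwards with p
    rw [norm_mul, sw_norm_exp, one_mul]
  · filter_upwards with p
    fun_prop

lemma swFT_conj {d : ℕ} (F : SwE d → ℂ) (k : SwE d) :
    swFT (fun p => (starRingEnd ℂ) (F p)) (-k) = (starRingEnd ℂ) (swFT F k) := by
  unfold swFT
  rw [← integral_conj]
  apply integral_congr_ae
  filter_upwards with p
  simp [swPr, ← Complex.exp_conj]
  left; congr 1; ring

lemma sw_gauss_l1 {V : Type*} [NormedAddCommGroup V] [InnerProductSpace ℝ V] [FiniteDimensional ℝ V]
    [MeasurableSpace V] [BorelSpace V] {η : ℝ} (hη : 0 < η) (m : ℝ) (hm : m = Module.finrank ℝ V / 2) :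
    ∫⁻ v : V, ‖((Real.pi : ℂ) / η) ^ (m : ℂ) * cexp (-(‖v‖ : ℂ) ^ 2 / (4 * η))‖ₑ =
      ENNReal.ofReal ((4 * Real.pi ^ 2) ^ m) := by
  have h1 : ∀ v : V, ‖((Real.pi : ℂ) / η) ^ (m : ℂ) * cexp (-(‖v‖ : ℂ) ^ 2 / (4 * η))‖ₑ =
      ENNReal.ofReal ((Real.pi / η) ^ m) * ENNReal.ofReal (Real.exp (-(1 / (4 * η)) * ‖v‖ ^ 2)) := by
    intro v
    rw [← ENNReal.ofReal_mul (by positivity), ← ofReal_norm]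
    congr 1
    rw [norm_mul]
    congr 1
    · rw [← ofReal_div, norm_cpow_eq_rpow_re_of_pos (by positivity)]; simp
    · have : (-(‖v‖ : ℂ) ^ 2 / (4 * η)) = ((-(1 / (4 * η)) * ‖v‖ ^ 2 : ℝ) : ℂ) := by
        push_cast; ring
      rw [this, norm_exp_ofReal]
  simp_rw [h1]
  rw [lintegral_const_mul _ (by fun_prop), ← ofReal_integral_eq_lintegral_ofReal]
  · rw [GaussianFourier.integral_rexp_neg_mul_sq_norm (by positivity), ← hm,
      ← ENNReal.ofReal_mul (by positivity), ← Real.mul_rpow (by positivity) (by positivity)]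
    congr 2; field_simp
  · by_contra h
    have h0 := integral_undef h
    rw [GaussianFourier.integral_rexp_neg_mul_sq_norm (by positivity)] at h0
    exact absurd h0 (by positivity)
  · filter_upwards with v; positivity

lemma swK_l1 {d : ℕ} {η : ℝ} (hη : 0 < η) :
    ∫⁻ q : SwE d, ‖swK (η : ℂ) (η : ℂ) q‖ₑ =
      ENNReal.ofReal ((4 * Real.pi ^ 2) ^ (1 / 2 : ℝ)) * ENNReal.ofReal ((4 * Real.pi ^ 2) ^ ((d : ℝ) / 2)) := by
  have h1 := sw_gauss_l1 (V := ℝ) hη (1/2) (by simp)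
  have h2 := sw_gauss_l1 (V := EuclideanSpace ℝ (Fin d)) hη (d/2) (by simp)
  rw [← h1, ← h2, ← lintegral_prod_mul]
  · simp_rw [← enorm_mul]
    simp [swK, Measure.volume_eq_prod]
  · fun_prop
  · fun_prop

lemma sw_enn_mul_le (a b : ℝ≥0∞) : a * b ≤ a ^ 2 + b ^ 2 := by
  rcases le_total a b with h | h
  · calc a * b ≤ b * b := by gcongr
      _ = b ^ 2 := by ring
      _ ≤ _ := le_add_self
  · calc a * b ≤ a * a := by gcongr
      _ = a ^ 2 := by ring
      _ ≤ _ := le_self_add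

/-- Schur type bound. -/
lemma sw_schur {d : ℕ} (F G K : SwE d → ℂ) (hF : AEMeasurable F) (hG : AEMeasurable G) (hK : Measurable K) :
    ∫⁻ z : SwE d × SwE d, ‖F z.1 * G z.2 * K (z.1 - z.2)‖ₑ ≤
      ((∫⁻ p, ‖F p‖ₑ ^ 2) + ∫⁻ p, ‖G p‖ₑ ^ 2) * ∫⁻ q, ‖K q‖ₑ := by
  have hK1 : ∀ p : SwE d, ∫⁻ p', ‖K (p - p')‖ₑ = ∫⁻ q, ‖K q‖ₑ := fun p =>
    lintegral_sub_left_eq_self (fun q => ‖K q‖ₑ) p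
  have hK2 : ∀ p : SwE d, ∫⁻ p', ‖K (p' - p)‖ₑ = ∫⁻ q, ‖K q‖ₑ := fun p =>
    lintegral_sub_right_eq_self (fun q => ‖K q‖ₑ) p
  have hKm : Measurable fun z : SwE d × SwE d => K (z.1 - z.2) := hK.comp (by fun_prop)
  have hF1 : AEMeasurable (fun z : SwE d × SwE d => F z.1) (volume.prod volume) :=
    hF.comp_quasiMeasurePreserving Measure.quasiMeasurePreserving_fst
  have hG1 : AEMeasurable (fun z : SwE d × SwE d => G z.2) (volume.prod volume) :=
    hG.comp_quasiMeasurePreserving Measure.quasiMeasurePreserving_snd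
  have hFK : AEMeasurable (fun z : SwE d × SwE d => ‖F z.1‖ₑ ^ 2 * ‖K (z.1 - z.2)‖ₑ)
      (volume.prod volume) := (hF1.enorm.pow_const 2).mul hKm.enorm.aemeasurable
  have hGK : AEMeasurable (fun z : SwE d × SwE d => ‖G z.2‖ₑ ^ 2 * ‖K (z.1 - z.2)‖ₑ)
      (volume.prod volume) := (hG1.enorm.pow_const 2).mul hKm.enorm.aemeasurable
  calc _ ≤ ∫⁻ z : SwE d × SwE d, (‖F z.1‖ₑ ^ 2 * ‖K (z.1 - z.2)‖ₑ + ‖G z.2‖ₑ ^ 2 * ‖K (z.1 - z.2)‖ₑ) := by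
        apply lintegral_mono
        intro z
        simp only [enorm_mul]
        rw [← add_mul]
        gcongr
        exact sw_enn_mul_le _ _
    _ = (∫⁻ z : SwE d × SwE d, ‖F z.1‖ₑ ^ 2 * ‖K (z.1 - z.2)‖ₑ) +
        ∫⁻ z : SwE d × SwE d, ‖G z.2‖ₑ ^ 2 * ‖K (z.1 - z.2)‖ₑ := by
        rw [Measure.volume_eq_prod, lintegral_add_left' hFK]
    _ = _ := by
        rw [add_mul]
        congr 1
        · rw [Measure.volume_eq_prod, lintegral_prod _ hFK,
            ← lintegral_mul_const'' _ (hF.enorm.pow_const 2)]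
          congr 1; ext p
          dsimp only
          rw [lintegral_const_mul _ (by fun_prop), hK1]
        · rw [Measure.volume_eq_prod, lintegral_prod_symm _ hGK,
            ← lintegral_mul_const'' _ (hG.enorm.pow_const 2)]
          congr 1; ext p
          dsimp only
          rw [lintegral_const_mul _ (by fun_prop), hK2]

def swC2 (d : ℕ) : ℝ≥0∞ := 2 * (ENNReal.ofReal ((4 * Real.pi ^ 2) ^ (1 / 2 : ℝ)) *
  ENNReal.ofReal ((4 * Real.pi ^ 2) ^ ((d : ℝ) / 2)))

lemma swC2_lt (d : ℕ) : swC2 d < ∞ := by unfold swC2; finiteness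

/-- Plancherel inequality. -/
lemma sw_plancherel {d : ℕ} {F : SwE d → ℂ} (hF : Integrable F) :
    ∫⁻ k, ‖swFT F k‖ₑ ^ 2 ≤ swC2 d * ∫⁻ p, ‖F p‖ₑ ^ 2 := by
  have hFc : Integrable (fun p => (starRingEnd ℂ) (F p)) := by
    refine hF.mono (continuous_conj.comp_aestronglyMeasurable hF.aestronglyMeasurable) ?_
    simp
  have key : ∀ η : ℝ, 0 < η → ∫⁻ k, ‖swM (η : ℂ) (η : ℂ) k‖ₑ * ‖swFT F k‖ₑ ^ 2 ≤
      swC2 d * ∫⁻ p, ‖F p‖ₑ ^ 2 := by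
    intro η hη
    have hMr : ∀ k : SwE d, swM (η : ℂ) (η : ℂ) k = ((Real.exp (-η * ‖k.1‖ ^ 2) *
        Real.exp (-η * ‖k.2‖ ^ 2) : ℝ) : ℂ) := by
      intro k; simp only [swM]; push_cast; rfl
    have hbd : ∀ k, ‖swFT F k‖ ≤ ∫ p, ‖F p‖ := by
      intro k
      refine (norm_integral_le_integral_norm _).trans (le_of_eq ?_)
      simp_rw [norm_mul, sw_norm_exp, one_mul]
    have hint : Integrable (fun k => (Real.exp (-η * ‖k.1‖ ^ 2) *
        Real.exp (-η * ‖k.2‖ ^ 2)) * ‖swFT F k‖ ^ 2 : SwE d → ℝ) := by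
      have h1 := (swM_integrable (d := d) (b := η) (c := η) (by simpa) (by simpa)).norm
      have h2 : Integrable (fun k : SwE d => Real.exp (-η * ‖k.1‖ ^ 2) *
        Real.exp (-η * ‖k.2‖ ^ 2)) := by
        refine h1.congr ?_
        filter_upwards with k
        rw [hMr, norm_real, Real.norm_of_nonneg (by positivity)]
      refine h2.mul_bdd (c := (∫ p, ‖F p‖) ^ 2) (by
        exact ((swFT_cont hF).norm.pow 2).aestronglyMeasurable) ?_
      filter_upwards with k
      rw [Real.norm_of_nonneg (by positivity)]
      gcongr
      exact hbd k
    have e1 : ∫⁻ k, ‖swM (η : ℂ) (η : ℂ) k‖ₑ * ‖swFT F k‖ₑ ^ 2 =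
        ENNReal.ofReal (∫ k : SwE d, (Real.exp (-η * ‖k.1‖ ^ 2) *
        Real.exp (-η * ‖k.2‖ ^ 2)) * ‖swFT F k‖ ^ 2) := by
      rw [ofReal_integral_eq_lintegral_ofReal hint (by filter_upwards with k; positivity)]
      congr 1; ext k
      rw [ENNReal.ofReal_mul (by positivity), ENNReal.ofReal_pow (by positivity), ofReal_norm,
        hMr, ← ofReal_norm, norm_real, Real.norm_of_nonneg (by positivity)]
    have e2 : (((∫ k : SwE d, (Real.exp (-η * ‖k.1‖ ^ 2) *
        Real.exp (-η * ‖k.2‖ ^ 2)) * ‖swFT F k‖ ^ 2) : ℝ) : ℂ) =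
        ∫ z : SwE d × SwE d, F z.1 * (starRingEnd ℂ) (F z.2) * swK η η (z.1 - z.2) := by
      rw [← sw_gauss_form (by simpa) (by simpa) hF hFc, ← integral_complex_ofReal]
      congr 1; ext k
      rw [swFT_conj, mul_conj, hMr, normSq_eq_norm_sq]
      push_cast; rfl
    have e3 : ENNReal.ofReal (∫ k : SwE d, (Real.exp (-η * ‖k.1‖ ^ 2) *
        Real.exp (-η * ‖k.2‖ ^ 2)) * ‖swFT F k‖ ^ 2) = ‖(((∫ k : SwE d, (Real.exp (-η * ‖k.1‖ ^ 2) *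
        Real.exp (-η * ‖k.2‖ ^ 2)) * ‖swFT F k‖ ^ 2) : ℝ) : ℂ)‖ₑ := by
      rw [← ofReal_norm, norm_real, Real.norm_of_nonneg]
      apply integral_nonneg; intro k; positivity
    rw [e1, e3, e2]
    refine (enorm_integral_le_lintegral_enorm _).trans ?_
    refine (sw_schur F (fun p => (starRingEnd ℂ) (F p)) (swK η η) hF.aestronglyMeasurable.aemeasurable
      hFc.aestronglyMeasurable.aemeasurable (swK_cont _ _).measurable).trans ?_
    rw [swK_l1 hη, swC2]
    apply le_of_eq
    have : ∀ p, ‖(starRingEnd ℂ) (F p)‖ₑ = ‖F p‖ₑ := fun p => by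
      rw [← ofReal_norm, ← ofReal_norm, RCLike.norm_conj]
    simp_rw [this]
    ring
  have hlim : ∀ k : SwE d, Filter.Tendsto (fun n : ℕ => ‖swM (((1 / ((n : ℝ) + 1) : ℝ)) : ℂ)
      (((1 / ((n : ℝ) + 1) : ℝ)) : ℂ) k‖ₑ * ‖swFT F k‖ₑ ^ 2) Filter.atTop (nhds (‖swFT F k‖ₑ ^ 2)) := by
    intro k
    have hc : Continuous (fun η : ℝ => swM (η : ℂ) (η : ℂ) k) := by unfold swM; fun_prop
    have h0 := (hc.tendsto 0).comp tendsto_one_div_add_atTop_nhds_zero_nat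
    have h1 : swM ((0 : ℝ) : ℂ) ((0 : ℝ) : ℂ) k = 1 := by simp [swM]
    rw [h1] at h0
    have h2 := (continuous_enorm.tendsto _).comp h0
    rw [enorm_one] at h2
    have := ENNReal.Tendsto.mul_const (b := ‖swFT F k‖ₑ ^ 2) h2 (Or.inl one_ne_zero)
    rw [one_mul] at this
    exact this
  calc ∫⁻ k, ‖swFT F k‖ₑ ^ 2 = ∫⁻ k, Filter.liminf (fun n : ℕ => ‖swM (((1 / ((n : ℝ) + 1) : ℝ)) : ℂ)
      (((1 / ((n : ℝ) + 1) : ℝ)) : ℂ) k‖ₑ * ‖swFT F k‖ₑ ^ 2) Filter.atTop := by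
        congr 1; ext k; exact (hlim k).liminf_eq.symm
    _ ≤ _ := lintegral_liminf_le (fun n => by
        have := (swFT_cont hF).measurable
        fun_prop)
    _ ≤ _ := by
        refine Filter.liminf_le_of_frequently_le' (Filter.Frequently.of_forall fun n => ?_)
        exact key _ (by positivity)

structure SwNice {d : ℕ} (F : SwE d → ℂ) : Prop where
  meas : Measurable F
  bdd : ∃ R : ℝ, ∀ p, ‖F p‖ ≤ R
  supp : ∃ S : Set (SwE d), MeasurableSet S ∧ volume S < ∞ ∧ ∀ p, p ∉ S → F p = 0

lemma SwNice.lint {d : ℕ} {F : SwE d → ℂ} (hF : SwNice F) (n : ℕ) (hn : n ≠ 0) :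
    ∫⁻ p, ‖F p‖ₑ ^ n < ∞ := by
  obtain ⟨R, hR⟩ := hF.bdd
  obtain ⟨S, hS, hSv, hS0⟩ := hF.supp
  calc ∫⁻ p, ‖F p‖ₑ ^ n ≤ ∫⁻ p, S.indicator (fun _ => (ENNReal.ofReal R) ^ n) p := by
        apply lintegral_mono
        intro p
        by_cases hp : p ∈ S
        · simp only [Set.indicator_of_mem hp]
          gcongr
          rw [← ofReal_norm]
          exact ENNReal.ofReal_le_ofReal (hR p)
        · simp [hS0 p hp, hn]
    _ = (ENNReal.ofReal R) ^ n * volume S := lintegral_indicator_const hS _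
    _ < ∞ := by finiteness

lemma SwNice.int {d : ℕ} {F : SwE d → ℂ} (hF : SwNice F) : Integrable F := by
  refine ⟨hF.meas.aestronglyMeasurable, ?_⟩
  have := hF.lint 1 one_ne_zero
  simpa [hasFiniteIntegral_iff_enorm] using this

lemma SwNice.conj {d : ℕ} {F : SwE d → ℂ} (hF : SwNice F) :
    SwNice (fun p => (starRingEnd ℂ) (F p)) := by
  obtain ⟨R, hR⟩ := hF.bdd
  obtain ⟨S, hS, hSv, hS0⟩ := hF.supp
  exact ⟨continuous_conj.measurable.comp hF.meas, ⟨R, by simpa using hR⟩,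
    ⟨S, hS, hSv, fun p hp => by simp [hS0 p hp]⟩⟩

lemma sw_prod_bound {d : ℕ} {F G : SwE d → ℂ} (hF : Integrable F) (hG : Integrable G) :
    ∫⁻ k, ‖swFT F k * swFT G (-k)‖ₑ ≤ swC2 d * ((∫⁻ p, ‖F p‖ₑ ^ 2) + ∫⁻ p, ‖G p‖ₑ ^ 2) := by
  have hm := (swFT_cont hF).measurable
  calc _ ≤ ∫⁻ k, (‖swFT F k‖ₑ ^ 2 + ‖swFT G (-k)‖ₑ ^ 2) := by
        apply lintegral_mono; intro k
        simp only [enorm_mul]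
        exact sw_enn_mul_le _ _
    _ = (∫⁻ k, ‖swFT F k‖ₑ ^ 2) + ∫⁻ k, ‖swFT G (-k)‖ₑ ^ 2 := lintegral_add_left (by fun_prop) _
    _ = (∫⁻ k, ‖swFT F k‖ₑ ^ 2) + ∫⁻ k, ‖swFT G k‖ₑ ^ 2 := by
        congr 1
        exact lintegral_neg_eq_self (μ := volume) (fun k => ‖swFT G k‖ₑ ^ 2)
    _ ≤ _ := by
        rw [mul_add]
        exact add_le_add (sw_plancherel hF) (sw_plancherel hG)

lemma sw_prod_int {d : ℕ} {F G : SwE d → ℂ} (hF : SwNice F) (hG : SwNice G) :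
    Integrable (fun k => swFT F k * swFT G (-k)) := by
  refine ⟨((swFT_cont hF.int).mul ((swFT_cont hG.int).comp continuous_neg)).aestronglyMeasurable, ?_⟩
  rw [hasFiniteIntegral_iff_enorm]
  refine (sw_prod_bound hF.int hG.int).trans_lt ?_
  exact ENNReal.mul_lt_top (swC2_lt d) (ENNReal.add_lt_top.2
    ⟨hF.lint 2 two_ne_zero, hG.lint 2 two_ne_zero⟩)

lemma sw_cpow_real_mul {r : ℝ} (hr : 0 < r) {z : ℂ} (hz : z ≠ 0) (c : ℂ) :
    ((r : ℂ) * z) ^ c = (r : ℂ) ^ c * z ^ c := by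
  have hr' : (r : ℂ) ≠ 0 := by exact_mod_cast hr.ne'
  rw [cpow_def_of_ne_zero (mul_ne_zero hr' hz), cpow_def_of_ne_zero hr', cpow_def_of_ne_zero hz,
    log_ofReal_mul hr hz, ← ofReal_log hr.le, ← Complex.exp_add]
  ring_nf

def swcK (d : ℕ) : ℂ := ((Real.pi : ℂ) / (-I)) ^ (1 / 2 : ℂ) * ((Real.pi : ℂ) / I) ^ ((d : ℂ) / 2)

def swRho {d : ℕ} (q : SwE d) : ℝ := (‖q.2‖ ^ 2 - ‖q.1‖ ^ 2) / 4

@[fun_prop]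
lemma swRho_cont {d : ℕ} : Continuous (swRho (d := d)) := by unfold swRho; fun_prop

lemma swK_formula {d : ℕ} {s : ℝ} (hs : 0 < s) (q : SwE d) :
    swK (-(I * s)) (I * s) q = swcK d * (s : ℂ) ^ (-((d : ℂ) + 1) / 2) * cexp (I * (swRho q / s : ℝ)) := by
  have hsc : (s : ℂ) ≠ 0 := by exact_mod_cast hs.ne'
  have hpi : (Real.pi : ℂ) ≠ 0 := by exact_mod_cast Real.pi_ne_zero
  have hi : ∀ c : ℂ, ((s⁻¹ : ℝ) : ℂ) ^ c = (s : ℂ) ^ (-c) := by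
    intro c
    rw [ofReal_inv, inv_cpow _ _ (by rw [arg_ofReal_of_nonneg hs.le]; exact Real.pi_pos.ne), cpow_neg]
  have e1 : (Real.pi : ℂ) / (-(I * s)) = ((s⁻¹ : ℝ) : ℂ) * (Real.pi / (-I)) := by
    push_cast; field_simp
  have e2 : (Real.pi : ℂ) / (I * s) = ((s⁻¹ : ℝ) : ℂ) * (Real.pi / I) := by
    push_cast; field_simp
  have hp : (s : ℂ) ^ (-((d : ℂ) + 1) / 2) = (s : ℂ) ^ (-(1 / 2 : ℂ)) * (s : ℂ) ^ (-((d : ℂ) / 2)) := by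
    rw [← cpow_add _ _ hsc]; congr 1; ring
  have he : cexp (I * (swRho q / s : ℝ)) = cexp (-(‖q.1‖ : ℂ) ^ 2 / (4 * (-(I * s)))) *
      cexp (-(‖q.2‖ : ℂ) ^ 2 / (4 * (I * s))) := by
    rw [← Complex.exp_add]; congr 1
    unfold swRho
    push_cast
    field_simp
    ring_nf
    simp only [I_sq]; ring
  rw [he, hp, swK, swcK, e1, e2, sw_cpow_real_mul (by positivity) (div_ne_zero hpi (by simp)),
    sw_cpow_real_mul (by positivity) (div_ne_zero hpi (by simp)), hi, hi]
  ring

lemma sw_norm_exp_le {b : ℂ} (hb : 0 ≤ b.re) (x : ℝ) : ‖cexp (-(x : ℂ) ^ 2 / (4 * b))‖ ≤ 1 := by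
  rw [norm_exp]
  apply Real.exp_le_one_iff.2
  have : (-(x : ℂ) ^ 2 / (4 * b)) = (((-(x ^ 2) / 4 : ℝ)) : ℂ) * b⁻¹ := by
    push_cast; rw [div_eq_mul_inv, mul_inv]; ring
  rw [this, re_ofReal_mul, inv_re]
  have : 0 ≤ b.re / normSq b := div_nonneg hb (normSq_nonneg b)
  nlinarith [sq_nonneg x]

lemma sw_norm_cpow_le {b : ℂ} {s : ℝ} (hs : 0 < s) (hb : s ≤ ‖b‖) (m : ℝ) (hm : 0 ≤ m) :
    ‖((Real.pi : ℂ) / b) ^ (m : ℂ)‖ ≤ (Real.pi / s) ^ m := by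
  rw [norm_cpow_real, norm_div, norm_real, Real.norm_of_nonneg Real.pi_pos.le]
  have := Real.pi_pos
  gcongr

lemma sw_Q {d : ℕ} {F G : SwE d → ℂ} (hF : SwNice F) (hG : SwNice G) {s : ℝ} (hs : 0 < s) :
    ∫ k, cexp (I * (s * (‖k.1‖ ^ 2 - ‖k.2‖ ^ 2) : ℝ)) * (swFT F k * swFT G (-k)) =
      ∫ z : SwE d × SwE d, F z.1 * G z.2 * swK (-(I * s)) (I * s) (z.1 - z.2) := by
  have hsc : (s : ℂ) ≠ 0 := by exact_mod_cast hs.ne'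
  let η : ℕ → ℝ := fun n => 1 / ((n : ℝ) + 1)
  have hη : ∀ n, 0 < η n := fun n => by positivity
  have hη0 : Filter.Tendsto η Filter.atTop (nhds 0) := tendsto_one_div_add_atTop_nhds_zero_nat
  have hid : ∀ n, ∫ k, swM (η n - I * s) (η n + I * s) k * (swFT F k * swFT G (-k)) =
      ∫ z : SwE d × SwE d, F z.1 * G z.2 * swK (η n - I * s) (η n + I * s) (z.1 - z.2) := by
    intro n
    exact sw_gauss_form (by simpa using hη n) (by simpa using hη n) hF.int hG.int
  have hL : Filter.Tendsto (fun n => ∫ k, swM (η n - I * s) (η n + I * s) k * (swFT F k * swFT G (-k)))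
      Filter.atTop (nhds (∫ k, cexp (I * (s * (‖k.1‖ ^ 2 - ‖k.2‖ ^ 2) : ℝ)) * (swFT F k * swFT G (-k)))) := by
    refine tendsto_integral_of_dominated_convergence (fun k => ‖swFT F k * swFT G (-k)‖) ?_
      (sw_prod_int hF hG).norm ?_ ?_
    · intro n
      exact (swM_cont _ _).aestronglyMeasurable.mul (sw_prod_int hF hG).aestronglyMeasurable
    · intro n
      filter_upwards with k
      rw [norm_mul]
      have : ‖swM (η n - I * s) (η n + I * s) k‖ ≤ 1 := by
        have h1 : ∀ (b : ℂ) (x : ℝ), 0 ≤ b.re → ‖cexp (-b * (x : ℂ) ^ 2)‖ ≤ 1 := by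
          intro b x hb
          rw [norm_exp]
          apply Real.exp_le_one_iff.2
          have : -b * (x : ℂ) ^ 2 = ((x ^ 2 : ℝ) : ℂ) * (-b) := by push_cast; ring
          rw [this, re_ofReal_mul, neg_re]
          nlinarith [sq_nonneg x]
        unfold swM
        rw [norm_mul]
        exact mul_le_one₀ (h1 _ _ (by simpa using (hη n).le)) (norm_nonneg _)
          (h1 _ _ (by simpa using (hη n).le))
      calc _ ≤ 1 * ‖swFT F k * swFT G (-k)‖ := by gcongr
        _ = _ := one_mul _
    · filter_upwards with k
      refine Filter.Tendsto.mul_const _ ?_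
      have hc : Continuous (fun t : ℝ => swM (t - I * s) (t + I * s) k) := by unfold swM; fun_prop
      have := (hc.tendsto 0).comp hη0
      have e : cexp (I * (s * (‖k.1‖ ^ 2 - ‖k.2‖ ^ 2) : ℝ)) =
          swM (((0 : ℝ) : ℂ) - I * s) (((0 : ℝ) : ℂ) + I * s) k := by
        simp only [swM]
        rw [← Complex.exp_add]
        congr 1
        push_cast; ring
      rw [e]
      exact this
  have hR : Filter.Tendsto (fun n => ∫ z : SwE d × SwE d, F z.1 * G z.2 *
      swK (η n - I * s) (η n + I * s) (z.1 - z.2)) Filter.atTop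
      (nhds (∫ z : SwE d × SwE d, F z.1 * G z.2 * swK (-(I * s)) (I * s) (z.1 - z.2))) := by
    have hFG : Integrable (fun z : SwE d × SwE d => F z.1 * G z.2) := hF.int.mul_prod hG.int
    refine tendsto_integral_of_dominated_convergence (fun z => ‖F z.1 * G z.2‖ *
      ((Real.pi / s) ^ (1 / 2 : ℝ) * 1 * ((Real.pi / s) ^ ((d : ℝ) / 2) * 1))) ?_
      (hFG.norm.mul_const _) ?_ ?_
    · intro n
      exact hFG.aestronglyMeasurable.mul ((swK_cont _ _).comp (by fun_prop)).aestronglyMeasurable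
    · intro n
      filter_upwards with z
      rw [norm_mul]
      gcongr
      have hn1 : s ≤ ‖(η n : ℂ) - I * s‖ := by
        have := abs_im_le_norm ((η n : ℂ) - I * s)
        simpa [abs_of_pos hs] using this
      have hn2 : s ≤ ‖(η n : ℂ) + I * s‖ := by
        have := abs_im_le_norm ((η n : ℂ) + I * s)
        simpa [abs_of_pos hs] using this
      have a1 := sw_norm_cpow_le hs hn1 (1/2) (by norm_num)
      have a2 := sw_norm_cpow_le hs hn2 ((d : ℝ)/2) (by positivity)
      have a3 := sw_norm_exp_le (b := (η n : ℂ) - I * s) (by simpa using (hη n).le) ‖(z.1 - z.2).1‖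
      have a4 := sw_norm_exp_le (b := (η n : ℂ) + I * s) (by simpa using (hη n).le) ‖(z.1 - z.2).2‖
      push_cast at a1 a2
      unfold swK
      rw [norm_mul, norm_mul, norm_mul]
      gcongr
    · filter_upwards with z
      refine Filter.Tendsto.const_mul _ ?_
      have hb : ContinuousAt (fun t : ℝ => (t : ℂ) - I * s) 0 := by fun_prop
      have hc : ContinuousAt (fun t : ℝ => (t : ℂ) + I * s) 0 := by fun_prop
      have hb0 : ((0 : ℝ) : ℂ) - I * s ≠ 0 := by simp [hsc]
      have hc0 : ((0 : ℝ) : ℂ) + I * s ≠ 0 := by simp [hsc]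
      have hpi := Real.pi_pos
      have hbs : (Real.pi : ℂ) / (((0 : ℝ) : ℂ) - I * s) ∈ slitPlane := by
        right; simp [div_im, normSq_apply, hs.ne', hpi.ne']
      have hcs : (Real.pi : ℂ) / (((0 : ℝ) : ℂ) + I * s) ∈ slitPlane := by
        right; simp [div_im, normSq_apply, hs.ne', hpi.ne']
      have hcont : ContinuousAt (fun t : ℝ => swK (t - I * s) (t + I * s) (z.1 - z.2)) 0 := by
        unfold swK
        refine ((ContinuousAt.cpow (continuousAt_const.div hb hb0) continuousAt_const hbs).mul ?_).mul
          ((ContinuousAt.cpow (continuousAt_const.div hc hc0) continuousAt_const hcs).mul ?_)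
        · exact (continuousAt_const.div (continuousAt_const.mul hb) (by simpa using hsc)).cexp
        · exact (continuousAt_const.div (continuousAt_const.mul hc) (by simpa using hsc)).cexp
      have := hcont.tendsto.comp hη0
      simpa [Function.comp_def] using this
  simp_rw [hid] at hL
  exact tendsto_nhds_unique hL hR

lemma sw_holo {X : Type*} [MeasurableSpace X] {μ : Measure X} {U : Set ℂ} (hU : IsOpen U)
    {f : ℂ → X → ℂ} {B : X → ℝ} (hm : ∀ w ∈ U, AEStronglyMeasurable (f w) μ)
    (hd : ∀ᵐ x ∂μ, DifferentiableOn ℂ (fun w => f w x) U) (hB : Integrable B μ)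
    (hb : ∀ᵐ x ∂μ, ∀ w ∈ U, ‖f w x‖ ≤ B x) :
    DifferentiableOn ℂ (fun w => ∫ x, f w x ∂μ) U := by
  intro w0 hw0
  obtain ⟨r0, hr0, hball⟩ := Metric.isOpen_iff.1 hU w0 hw0
  set r := r0 / 2 with hr
  have hr1 : 0 < r := by positivity
  have hcb : ∀ w ∈ Metric.ball w0 r, Metric.closedBall w r ⊆ U := by
    intro w hw v hv
    apply hball
    rw [Metric.mem_ball] at *
    rw [Metric.mem_closedBall] at hv
    have := dist_triangle v w w0
    linarith
  have hbU : Metric.ball w0 r ⊆ U := fun w hw => hcb w hw (Metric.mem_closedBall_self hr1.le)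
  have key := hasDerivAt_integral_of_dominated_loc_of_deriv_le (μ := μ) (𝕜 := ℂ)
    (F := f) (F' := fun w x => deriv (fun w => f w x) w) (x₀ := w0) (s := Metric.ball w0 r)
    (bound := fun x => B x / r) (Metric.ball_mem_nhds _ hr1) ?_ ?_ ?_ ?_ (hB.div_const r) ?_
  · exact key.2.differentiableAt.differentiableWithinAt
  · filter_upwards [hU.mem_nhds hw0] with w hw using hm w hw
  · refine hB.mono' (hm w0 hw0) ?_
    filter_upwards [hb] with x hx using hx w0 hw0
  · let u : ℕ → ℂ := fun n => w0 + ((r / ((n : ℝ) + 2) : ℝ) : ℂ)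
    have hu0 : ∀ n, u n ≠ w0 := by
      intro n h
      have h1 : ((r / ((n : ℝ) + 2) : ℝ) : ℂ) = 0 := by simpa [u] using h
      rw [ofReal_eq_zero] at h1
      have : 0 < r / ((n : ℝ) + 2) := by positivity
      exact this.ne' h1
    have hut : Filter.Tendsto u Filter.atTop (nhds w0) := by
      have h1 : Filter.Tendsto (fun n : ℕ => r / ((n : ℝ) + 2)) Filter.atTop (nhds 0) := by
        apply Filter.Tendsto.div_atTop tendsto_const_nhds
        exact Filter.tendsto_atTop_add_const_right _ _ tendsto_natCast_atTop_atTop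
      have h2 := ((continuous_ofReal.tendsto 0).comp h1).const_add w0
      simpa [u, Function.comp_def] using h2
    have huU : ∀ n, u n ∈ U := by
      intro n
      apply hbU
      rw [Metric.mem_ball, dist_eq_norm]
      have : u n - w0 = ((r / ((n : ℝ) + 2) : ℝ) : ℂ) := by simp [u]
      rw [this, norm_real, Real.norm_of_nonneg (by positivity), div_lt_iff₀ (by positivity)]
      have : (0 : ℝ) ≤ n := by positivity
      nlinarith
    refine aestronglyMeasurable_of_tendsto_ae (u := Filter.atTop)
      (f := fun (n : ℕ) x => slope (fun w => f w x) w0 (u n)) ?_ ?_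
    · intro n
      simp only [slope_def_field, div_eq_mul_inv]
      exact ((hm _ (huU n)).sub (hm _ hw0)).mul_const _
    · filter_upwards [hd] with x hx
      have h1 := (hx.differentiableAt (hU.mem_nhds hw0)).hasDerivAt
      rw [hasDerivAt_iff_tendsto_slope] at h1
      refine h1.comp ?_
      rw [tendsto_nhdsWithin_iff]
      exact ⟨hut, Filter.Eventually.of_forall hu0⟩
  · filter_upwards [hd, hb] with x hx hbx w hw
    refine norm_deriv_le_of_forall_mem_sphere_norm_le hr1 ?_ ?_
    · refine (hx.mono (hcb w hw)).diffContOnCl_ball subset_rfl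
    · intro v hv
      exact hbx v (hcb w hw (Metric.sphere_subset_closedBall hv))
  · filter_upwards [hd] with x hx w hw
    exact (hx.differentiableAt (hU.mem_nhds (hbU hw))).hasDerivAt

/-- The three-fold integral with a power of `s`. -/
def swT {d : ℕ} (a b : ℝ) (c : ℂ) (F G : SwE d → ℂ) : ℂ :=
  ∫ x : ℝ × (SwE d × SwE d), (x.1 : ℂ) ^ c * (F x.2.1 * G x.2.2 *
    cexp (I * (swRho (x.2.1 - x.2.2) / x.1 : ℝ))) ∂((volume.restrict (Set.Ioc a b)).prod volume)

lemma sw_cpow_intOn {a b : ℝ} (ha : 0 < a) (c : ℂ) :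
    Integrable (fun s : ℝ => (s : ℂ) ^ c) (volume.restrict (Set.Ioc a b)) := by
  have : IntegrableOn (fun s : ℝ => (s : ℂ) ^ c) (Set.Icc a b) := by
    apply ContinuousOn.integrableOn_Icc
    intro s hs
    exact (continuousAt_ofReal_cpow_const s _ (Or.inr (ha.trans_le hs.1).ne')).continuousWithinAt
  exact this.mono_set Set.Ioc_subset_Icc_self

lemma swT_int {d : ℕ} {a b : ℝ} (ha : 0 < a) (c : ℂ) {F G : SwE d → ℂ} (hF : Integrable F)
    (hG : Integrable G) :
    Integrable (fun x : ℝ × (SwE d × SwE d) => (x.1 : ℂ) ^ c * (F x.2.1 * G x.2.2 *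
    cexp (I * (swRho (x.2.1 - x.2.2) / x.1 : ℝ)))) ((volume.restrict (Set.Ioc a b)).prod volume) := by
  have h : Integrable (fun x : ℝ × (SwE d × SwE d) => (x.1 : ℂ) ^ c * (F x.2.1 * G x.2.2))
      ((volume.restrict (Set.Ioc a b)).prod volume) :=
    (sw_cpow_intOn ha c).mul_prod (hF.mul_prod hG)
  have h2 := sw_int_phase h (φ := fun x => swRho (x.2.1 - x.2.2) / x.1) (by
    apply Measurable.aestronglyMeasurable
    exact (swRho_cont.measurable.comp (by fun_prop)).div (by fun_prop))
  refine h2.congr ?_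
  filter_upwards with x
  ring

lemma swT_right {d : ℕ} {a b : ℝ} (ha : 0 < a) (hab : a ≤ b) {F G : SwE d → ℂ} (hF : Integrable F)
    (hG : Integrable G) (hF1 : ∫⁻ p, ‖F p‖ₑ ≤ 1) (hG1 : ∫⁻ p, ‖G p‖ₑ ≤ 1) (y : ℝ) (hy : y ≠ 0) :
    ‖swT a b (-1 + I * y) F G‖ ≤ 2 / |y| + 4 + |y| := by
  have hC : 0 ≤ 2 / |y| + 4 + |y| := by positivity
  unfold swT
  rw [integral_prod_symm _ (swT_int ha _ hF hG)]
  have hle : ‖∫ z : SwE d × SwE d, ∫ s in Set.Ioc a b, (s : ℂ) ^ (-1 + I * (y : ℂ)) *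
      (F z.1 * G z.2 * cexp (I * (swRho (z.1 - z.2) / s : ℝ)))‖ ≤
      ∫ z : SwE d × SwE d, (2 / |y| + 4 + |y|) * (‖F z.1‖ * ‖G z.2‖) := by
    refine norm_integral_le_of_norm_le ((hF.norm.mul_prod hG.norm).const_mul _) ?_
    filter_upwards with z
    have : ∀ s : ℝ, (s : ℂ) ^ (-1 + I * (y : ℂ)) *
      (F z.1 * G z.2 * cexp (I * (swRho (z.1 - z.2) / s : ℝ))) = F z.1 * G z.2 *
        ((s : ℂ) ^ (-1 + I * (y : ℂ)) * cexp (I * (swRho (z.1 - z.2) / s : ℝ))) := by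
      intro s; ring
    simp_rw [this]
    rw [integral_const_mul, norm_mul, norm_mul, mul_comm]
    gcongr
    have := sw_osc_inv y hy a b (swRho (z.1 - z.2)) ha hab
    rwa [intervalIntegral.integral_of_le hab] at this
  refine hle.trans ?_
  rw [integral_const_mul, Measure.volume_eq_prod, integral_prod_mul (fun p => ‖F p‖) (fun p => ‖G p‖)]
  have e : ∀ H : SwE d → ℂ, Integrable H → ∫⁻ p, ‖H p‖ₑ ≤ 1 → ∫ p, ‖H p‖ ≤ 1 := by
    intro H hH h1
    rw [integral_norm_eq_lintegral_enorm hH.aestronglyMeasurable]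
    exact ENNReal.toReal_le_of_le_ofReal zero_le_one (by simpa using h1)
  have h1 := e F hF hF1
  have h2 := e G hG hG1
  have h3 : (∫ p, ‖F p‖) * ∫ p, ‖G p‖ ≤ 1 :=
    mul_le_one₀ h1 (integral_nonneg fun _ => norm_nonneg _) h2
  calc _ ≤ (2 / |y| + 4 + |y|) * 1 := by gcongr
    _ = _ := mul_one _

lemma swT_eq {d : ℕ} {a b : ℝ} (ha : 0 < a) (c : ℂ) {F G : SwE d → ℂ} (hF : SwNice F)
    (hG : SwNice G) :
    swcK d * swT a b (c + -((d : ℂ) + 1) / 2) F G = ∫ s in Set.Ioc a b, (s : ℂ) ^ c *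
      ∫ k, cexp (I * (s * (‖k.1‖ ^ 2 - ‖k.2‖ ^ 2) : ℝ)) * (swFT F k * swFT G (-k)) := by
  unfold swT
  rw [integral_prod _ (swT_int ha _ hF.int hG.int), ← integral_const_mul]
  apply setIntegral_congr_fun measurableSet_Ioc
  intro s hs
  have hs0 : 0 < s := ha.trans hs.1
  dsimp only
  rw [sw_Q hF hG hs0, ← integral_const_mul, ← integral_const_mul]
  congr 1; ext z
  rw [swK_formula hs0, cpow_add _ _ (by exact_mod_cast hs0.ne')]
  ring

lemma sw_sk_int {d : ℕ} {a b : ℝ} (ha : 0 < a) (c : ℂ) {F G : SwE d → ℂ} (hF : SwNice F)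
    (hG : SwNice G) :
    Integrable (fun x : ℝ × SwE d => (x.1 : ℂ) ^ c *
      (cexp (I * (x.1 * (‖x.2.1‖ ^ 2 - ‖x.2.2‖ ^ 2) : ℝ)) * (swFT F x.2 * swFT G (-x.2))))
      ((volume.restrict (Set.Ioc a b)).prod volume) := by
  have h : Integrable (fun x : ℝ × SwE d => (x.1 : ℂ) ^ c * (swFT F x.2 * swFT G (-x.2)))
      ((volume.restrict (Set.Ioc a b)).prod volume) :=
    (sw_cpow_intOn ha c).mul_prod (sw_prod_int hF hG)
  have h2 := sw_int_phase h (φ := fun x => x.1 * (‖x.2.1‖ ^ 2 - ‖x.2.2‖ ^ 2)) (by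
    apply Continuous.aestronglyMeasurable
    fun_prop)
  refine h2.congr ?_
  filter_upwards with x
  ring

lemma swT_left {d : ℕ} {a b : ℝ} (ha : 0 < a) (hab : a ≤ b) {F G : SwE d → ℂ} (hF : SwNice F)
    (hG : SwNice G) (hF1 : ∫⁻ p, ‖F p‖ₑ ^ 2 ≤ 1) (hG1 : ∫⁻ p, ‖G p‖ₑ ^ 2 ≤ 1) (y : ℝ) (hy : y ≠ 0) :
    ‖swcK d * swT a b (-1 + I * y + -((d : ℂ) + 1) / 2) F G‖ ≤
      (2 / |y| + 4 + |y|) * (2 * (swC2 d).toReal) := by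
  have hC : 0 ≤ 2 / |y| + 4 + |y| := by positivity
  rw [swT_eq ha _ hF hG]
  simp_rw [← integral_const_mul]
  rw [integral_integral_swap (sw_sk_int ha _ hF hG)]
  have hle : ‖∫ k : SwE d, ∫ s in Set.Ioc a b, (s : ℂ) ^ (-1 + I * (y : ℂ)) *
      (cexp (I * (s * (‖k.1‖ ^ 2 - ‖k.2‖ ^ 2) : ℝ)) * (swFT F k * swFT G (-k)))‖ ≤
      ∫ k : SwE d, (2 / |y| + 4 + |y|) * ‖swFT F k * swFT G (-k)‖ := by
    refine norm_integral_le_of_norm_le ((sw_prod_int hF hG).norm.const_mul _) ?_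
    filter_upwards with k
    have : ∀ s : ℝ, (s : ℂ) ^ (-1 + I * (y : ℂ)) *
      (cexp (I * (s * (‖k.1‖ ^ 2 - ‖k.2‖ ^ 2) : ℝ)) * (swFT F k * swFT G (-k))) =
        ((s : ℂ) ^ (-1 + I * (y : ℂ)) * cexp (I * ((‖k.1‖ ^ 2 - ‖k.2‖ ^ 2) * s : ℝ))) *
        (swFT F k * swFT G (-k)) := by
      intro s; rw [mul_comm s]; ring
    simp_rw [this]
    rw [integral_mul_const, norm_mul]
    gcongr
    have := sw_osc y hy a b (‖k.1‖ ^ 2 - ‖k.2‖ ^ 2) ha hab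
    rwa [intervalIntegral.integral_of_le hab] at this
  refine hle.trans ?_
  rw [integral_const_mul]
  gcongr
  rw [integral_norm_eq_lintegral_enorm (sw_prod_int hF hG).aestronglyMeasurable]
  have h1 := sw_prod_bound hF.int hG.int
  have h2 : ∫⁻ k, ‖swFT F k * swFT G (-k)‖ₑ ≤ 2 * swC2 d := by
    refine h1.trans ?_
    rw [mul_comm]
    gcongr
    calc _ ≤ (1 : ℝ≥0∞) + 1 := add_le_add hF1 hG1
      _ = 2 := by norm_num
  calc _ ≤ (2 * swC2 d).toReal := ENNReal.toReal_mono (by have := (swC2_lt d).ne; finiteness) h2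
    _ = _ := by simp

def swPow {d : ℕ} (P : ℝ) (F : SwE d → ℂ) (w : ℂ) (p : SwE d) : ℂ :=
  F p / (‖F p‖ : ℂ) * (‖F p‖ : ℂ) ^ ((P : ℂ) * (1 + w) / 2)

lemma swPow_norm {d : ℕ} {P : ℝ} (hP : 0 < P) (F : SwE d → ℂ) {w : ℂ} (hw : -1 < w.re) (p : SwE d) :
    ‖swPow P F w p‖ = ‖F p‖ ^ (P * (1 + w.re) / 2) := by
  unfold swPow
  have hpos : 0 < P * (1 + w.re) / 2 := by
    have : 0 < 1 + w.re := by linarith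
    positivity
  by_cases h : F p = 0
  · simp [h, Real.zero_rpow hpos.ne']
  · have hn : 0 < ‖F p‖ := norm_pos_iff.2 h
    rw [norm_mul, norm_div, norm_real, norm_norm, div_self hn.ne', one_mul,
      norm_cpow_eq_rpow_re_of_pos hn]
    congr 1
    have : (P : ℂ) * (1 + w) / 2 = ((P / 2 : ℝ) : ℂ) * (1 + w) := by push_cast; ring
    rw [this, re_ofReal_mul]
    simp; ring

lemma swPow_enorm {d : ℕ} {P : ℝ} (hP : 0 < P) (F : SwE d → ℂ) {w : ℂ} (hw : -1 < w.re) (p : SwE d) :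
    ‖swPow P F w p‖ₑ = ‖F p‖ₑ ^ (P * (1 + w.re) / 2) := by
  have hpos : 0 < P * (1 + w.re) / 2 := by
    have : 0 < 1 + w.re := by linarith
    positivity
  rw [← ofReal_norm, swPow_norm hP F hw, ← ENNReal.ofReal_rpow_of_nonneg (norm_nonneg _) hpos.le,
    ofReal_norm]

lemma swPow_self {d : ℕ} {P : ℝ} (F : SwE d → ℂ) {w : ℂ} (hw : (P : ℂ) * (1 + w) / 2 = 1) :
    swPow P F w = F := by
  funext p
  unfold swPow
  rw [hw, cpow_one]
  by_cases h : F p = 0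
  · simp [h]
  · have hn : (‖F p‖ : ℂ) ≠ 0 := by exact_mod_cast (norm_pos_iff.2 h).ne'
    field_simp

lemma swPow_bdd {d : ℕ} {P : ℝ} (hP : 0 < P) {F : SwE d → ℂ} {R : ℝ} (hR1 : 1 ≤ R)
    (hR : ∀ p, ‖F p‖ ≤ R) {w : ℂ} (hw : -1 < w.re) (hw2 : w.re ≤ 2) (p : SwE d) :
    ‖swPow P F w p‖ ≤ R ^ (P * 2) := by
  rw [swPow_norm hP F hw]
  have h0 : 0 ≤ P * (1 + w.re) / 2 := by
    have : 0 < 1 + w.re := by linarith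
    positivity
  calc ‖F p‖ ^ (P * (1 + w.re) / 2) ≤ R ^ (P * (1 + w.re) / 2) :=
        Real.rpow_le_rpow (norm_nonneg _) (hR p) h0
    _ ≤ _ := Real.rpow_le_rpow_of_exponent_le hR1 (by nlinarith)

lemma swPow_meas {d : ℕ} {P : ℝ} {F : SwE d → ℂ} (hF : Measurable F) (w : ℂ) :
    Measurable (swPow P F w) := by
  unfold swPow
  have h1 : Measurable (fun p => (‖F p‖ : ℂ)) := measurable_ofReal.comp hF.norm
  exact (hF.div h1).mul (h1.pow_const _)

lemma swPow_nice {d : ℕ} {P : ℝ} (hP : 0 < P) {F : SwE d → ℂ} (hF : SwNice F) {w : ℂ}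
    (hw : -1 < w.re) (hw2 : w.re ≤ 2) : SwNice (swPow P F w) := by
  obtain ⟨R, hR⟩ := hF.bdd
  obtain ⟨S, hS, hSv, hS0⟩ := hF.supp
  refine ⟨swPow_meas hF.meas w, ⟨(max R 1) ^ (P * 2), fun p => swPow_bdd hP (le_max_right _ _)
    (fun p => (hR p).trans (le_max_left _ _)) hw hw2 p⟩, S, hS, hSv, fun p hp => ?_⟩
  simp [swPow, hS0 p hp]

lemma swPow_diff {d : ℕ} {P : ℝ} (F : SwE d → ℂ) (p : SwE d) :
    Differentiable ℂ (fun w => swPow P F w p) := by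
  unfold swPow
  by_cases h : F p = 0
  · simp [h]
  · have hn : (‖F p‖ : ℂ) ≠ 0 := by exact_mod_cast (norm_pos_iff.2 h).ne'
    intro w
    refine DifferentiableAt.const_mul ?_ _
    refine DifferentiableAt.const_cpow ?_ (Or.inl hn)
    fun_prop

lemma sw_rpow_bd {a b L E e s : ℝ} (ha : 0 < a) (hs : s ∈ Set.Ioc a b) (hL1 : 1 ≤ L) (hbL : b ≤ L)
    (haL : 1 / a ≤ L) (he : |e| ≤ E) : s ^ e ≤ L ^ E := by
  have hs0 : 0 < s := ha.trans hs.1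
  have hL0 : 0 < L := by linarith
  rw [Real.rpow_def_of_pos hs0, Real.rpow_def_of_pos hL0]
  apply Real.exp_le_exp.2
  have h1 : |Real.log s| ≤ Real.log L := by
    rw [abs_le]
    constructor
    · rw [← Real.log_inv]
      apply Real.log_le_log (by positivity)
      rw [inv_le_comm₀ hL0 hs0]
      calc s⁻¹ ≤ a⁻¹ := by gcongr; exact hs.1.le
        _ ≤ L := by simpa using haL
    · exact Real.log_le_log hs0 (hs.2.trans hbL)
  calc Real.log s * e ≤ |Real.log s * e| := le_abs_self _
    _ = |Real.log s| * |e| := abs_mul _ _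
    _ ≤ _ := mul_le_mul h1 he (abs_nonneg _) ((abs_nonneg _).trans h1)

def swStrip : Set ℂ := {w | -(1/2) < w.re ∧ w.re < 3 / 2}

lemma swStrip_open : IsOpen swStrip :=
  (isOpen_lt continuous_const continuous_re).inter (isOpen_lt continuous_re continuous_const)

lemma swT_family {d : ℕ} {a b P D : ℝ} (ha : 0 < a) (hP : 0 < P) (hD : 0 < D) {F G : SwE d → ℂ}
    (hF : SwNice F) (hG : SwNice G) :
    DifferentiableOn ℂ (fun w => swT a b (-1 + D * w - D) (swPow P F w) (swPow P G w)) swStrip ∧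
    ∃ M : ℝ, ∀ w ∈ swStrip, ‖swT a b (-1 + D * w - D) (swPow P F w) (swPow P G w)‖ ≤ M := by
  obtain ⟨R, hR⟩ := hF.bdd
  obtain ⟨S, hS, hSv, hS0⟩ := hF.supp
  obtain ⟨R', hR'⟩ := hG.bdd
  obtain ⟨S', hS', hSv', hS0'⟩ := hG.supp
  set Q := (max (max R R') 1) ^ (P * 2) with hQ
  have hQ0 : 0 ≤ Q := by positivity
  set L := max (max b (1 / a)) 1 with hL
  set E := 1 + D * 3 with hE
  let B : ℝ × (SwE d × SwE d) → ℝ := fun x => L ^ E * (S.indicator (fun _ => Q) x.2.1 *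
    S'.indicator (fun _ => Q) x.2.2)
  have hBint : Integrable B ((volume.restrict (Set.Ioc a b)).prod volume) := by
    have h1 : Integrable (S.indicator (fun _ : SwE d => Q)) :=
      (integrable_indicator_iff hS).2 (integrableOn_const hSv.ne)
    have h2 : Integrable (S'.indicator (fun _ : SwE d => Q)) :=
      (integrable_indicator_iff hS').2 (integrableOn_const hSv'.ne)
    have h0 : Integrable (fun _ : ℝ => L ^ E) (volume.restrict (Set.Ioc a b)) :=
      integrableOn_const (by simp)
    exact h0.mul_prod (h1.mul_prod h2)
  have hmem : ∀ᵐ x ∂((volume.restrict (Set.Ioc a b)).prod (volume : Measure (SwE d × SwE d))),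
      x.1 ∈ Set.Ioc a b :=
    Measure.quasiMeasurePreserving_fst.ae (ae_restrict_mem measurableSet_Ioc)
  have hbd : ∀ᵐ x ∂((volume.restrict (Set.Ioc a b)).prod (volume : Measure (SwE d × SwE d))),
      ∀ w ∈ swStrip, ‖(x.1 : ℂ) ^ (-1 + D * w - D) * (swPow P F w x.2.1 * swPow P G w x.2.2 *
        cexp (I * (swRho (x.2.1 - x.2.2) / x.1 : ℝ)))‖ ≤ B x := by
    filter_upwards [hmem] with x hx w hw
    have hw1 : -1 < w.re := by linarith [hw.1]
    have hw2 : w.re ≤ 2 := by linarith [hw.2]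
    have hx0 : 0 < x.1 := ha.trans hx.1
    rw [norm_mul, norm_mul, norm_mul, sw_norm_exp, mul_one]
    refine mul_le_mul ?_ (mul_le_mul ?_ ?_ (norm_nonneg _) ?_) (by positivity) (by positivity)
    · rw [norm_cpow_eq_rpow_re_of_pos hx0]
      refine sw_rpow_bd ha hx (le_max_right _ _) ((le_max_left _ _).trans (le_max_left _ _))
        ((le_max_right _ _).trans (le_max_left _ _)) ?_
      have : (-1 + (D : ℂ) * w - D).re = -1 + D * w.re - D := by simp
      rw [this, abs_le]
      constructor
      · nlinarith [hw.1]
      · nlinarith [hw.2]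
    · by_cases hp : x.2.1 ∈ S
      · rw [Set.indicator_of_mem hp]
        exact swPow_bdd hP (le_max_right _ _)
          (fun p => (hR p).trans ((le_max_left _ _).trans (le_max_left _ _))) hw1 hw2 _
      · rw [Set.indicator_of_notMem hp]; simp [swPow, hS0 _ hp]
    · by_cases hp : x.2.2 ∈ S'
      · rw [Set.indicator_of_mem hp]
        exact swPow_bdd hP (le_max_right _ _)
          (fun p => (hR' p).trans ((le_max_right _ _).trans (le_max_left _ _))) hw1 hw2 _
      · rw [Set.indicator_of_notMem hp]; simp [swPow, hS0' _ hp]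
    · exact Set.indicator_nonneg (fun _ _ => hQ0) _
  constructor
  · refine sw_holo swStrip_open ?_ ?_ hBint hbd
    · intro w hw
      have hw1 : -1 < w.re := by linarith [hw.1]
      have hw2 : w.re ≤ 2 := by linarith [hw.2]
      exact (swT_int ha _ (swPow_nice hP hF hw1 hw2).int (swPow_nice hP hG hw1 hw2).int).1
    · filter_upwards [hmem] with x hx
      have hx0 : (x.1 : ℂ) ≠ 0 := by exact_mod_cast (ha.trans hx.1).ne'
      apply Differentiable.differentiableOn
      refine Differentiable.mul ?_ (((swPow_diff F _).mul (swPow_diff G _)).mul_const _)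
      intro w
      refine DifferentiableAt.const_cpow ?_ (Or.inl hx0)
      fun_prop
  · refine ⟨∫ x, B x ∂((volume.restrict (Set.Ioc a b)).prod volume), fun w hw => ?_⟩
    refine norm_integral_le_of_norm_le hBint ?_
    filter_upwards [hbd] with x hx using hx w hw

def swPhi (w : ℂ) : ℂ := w * (w - 1) / (w + 2) ^ 3

lemma sw_norm_w2 {w : ℂ} (hw : -(1/2) ≤ w.re) : 1 ≤ ‖w + 2‖ ∧ 1 + w.im ^ 2 ≤ ‖w + 2‖ ^ 2 ∧
    ‖w‖ ≤ ‖w + 2‖ ∧ ‖w - 1‖ ≤ ‖w + 2‖ := by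
  have h2 : ‖w + 2‖ ^ 2 = (w.re + 2) ^ 2 + w.im ^ 2 := by
    rw [← normSq_eq_norm_sq, normSq_apply]; simp; ring
  have h0 : ‖w‖ ^ 2 = (w.re) ^ 2 + w.im ^ 2 := by
    rw [← normSq_eq_norm_sq, normSq_apply]; ring
  have h1 : ‖w - 1‖ ^ 2 = (w.re - 1) ^ 2 + w.im ^ 2 := by
    rw [← normSq_eq_norm_sq, normSq_apply]; simp; ring
  refine ⟨?_, ?_, ?_, ?_⟩
  · nlinarith [norm_nonneg (w + 2), sq_nonneg w.im]
  · nlinarith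
  · apply le_of_sq_le_sq _ (norm_nonneg _); nlinarith
  · apply le_of_sq_le_sq _ (norm_nonneg _); nlinarith

lemma swPhi_le {w : ℂ} (hw : -(1/2) ≤ w.re) : ‖swPhi w‖ ≤ ‖w‖ / (1 + w.im ^ 2) ∧
    ‖swPhi w‖ ≤ ‖w - 1‖ / (1 + w.im ^ 2) ∧ ‖swPhi w‖ ≤ 1 := by
  obtain ⟨h1, h2, h3, h4⟩ := sw_norm_w2 hw
  have hp : 0 < ‖w + 2‖ := by linarith
  have e : ‖swPhi w‖ = ‖w‖ * ‖w - 1‖ / ‖w + 2‖ ^ 3 := by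
    unfold swPhi; rw [norm_div, norm_mul, norm_pow]
  have k1 : ‖w‖ * ‖w - 1‖ / ‖w + 2‖ ^ 3 ≤ ‖w‖ * ‖w + 2‖ / ‖w + 2‖ ^ 3 := by gcongr
  have k2 : ‖w‖ * ‖w - 1‖ / ‖w + 2‖ ^ 3 ≤ ‖w + 2‖ * ‖w - 1‖ / ‖w + 2‖ ^ 3 := by gcongr
  have k3 : ‖w‖ * ‖w + 2‖ / ‖w + 2‖ ^ 3 = ‖w‖ / ‖w + 2‖ ^ 2 := by field_simp
  have k4 : ‖w + 2‖ * ‖w - 1‖ / ‖w + 2‖ ^ 3 = ‖w - 1‖ / ‖w + 2‖ ^ 2 := by field_simp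
  rw [e]
  refine ⟨?_, ?_, ?_⟩
  · rw [k3] at k1; refine k1.trans ?_; gcongr
  · rw [k4] at k2; refine k2.trans ?_; gcongr
  · rw [k3] at k1; refine k1.trans ?_
    rw [div_le_one (by positivity)]; nlinarith

lemma sw_line_bd {D y : ℝ} (hD : 0 < D) (hy : y ≠ 0) :
    |y| / (1 + y ^ 2) * (2 / |D * y| + 4 + |D * y|) ≤ 2 / D + 4 + D := by
  have hy' : 0 < |y| := abs_pos.2 hy
  rw [abs_mul, abs_of_pos hD, ← sq_abs y]
  set t := |y|
  rw [div_mul_eq_mul_div, div_le_iff₀ (by positivity)]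
  have : t * (2 / (D * t) + 4 + D * t) = 2 / D + 4 * t + D * t ^ 2 := by field_simp
  rw [this]
  have h2 : 0 < 2 / D := by positivity
  nlinarith [sq_nonneg (t - 1), sq_nonneg t, mul_pos h2 (pow_pos hy' 2)]

def swCI (d : ℕ) : ℝ :=
  (2 / (((d : ℝ) + 1) / 2) + 4 + ((d : ℝ) + 1) / 2) * (2 * (swC2 d).toReal + ‖swcK d‖ + 1) /
    ‖swPhi (2 / ((d : ℂ) + 1))‖

lemma sw_interp {d : ℕ} (hd : 2 ≤ d) {a b P : ℝ} (ha : 0 < a) (hab : a ≤ b)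
    (hP : P = 2 * ((d : ℝ) + 1) / (d + 3)) {F G : SwE d → ℂ}
    (hF : SwNice F) (hG : SwNice G) (hF1 : ∫⁻ p, ‖F p‖ₑ ^ P ≤ 1) (hG1 : ∫⁻ p, ‖G p‖ₑ ^ P ≤ 1) :
    ‖swcK d * swT a b (-((d : ℂ) + 1) / 2) F G‖ ≤ swCI d := by
  have hd' : (2 : ℝ) ≤ d := by exact_mod_cast hd
  have hP0 : 0 < P := by rw [hP]; positivity
  set D : ℝ := ((d : ℝ) + 1) / 2 with hDdef
  have hD : 0 < D := by positivity
  have hDc : (D : ℂ) = ((d : ℂ) + 1) / 2 := by rw [hDdef]; push_cast; ring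
  obtain ⟨hdiff, M, hM⟩ := swT_family (a := a) (b := b) ha hP0 hD hF hG
  let f : ℂ → ℂ := fun w => swPhi w * (swcK d * swT a b (-1 + D * w - D) (swPow P F w) (swPow P G w))
  set A : ℝ := (2 / D + 4 + D) * (2 * (swC2 d).toReal + ‖swcK d‖ + 1) with hA
  have hA0 : 0 < A := by positivity
  have hB0 : 0 < 2 / D + 4 + D := by positivity
  have hsub : closure (HadamardThreeLines.verticalStrip 0 1) ⊆ swStrip := by
    intro w hw
    unfold HadamardThreeLines.verticalStrip at hw
    have := closure_preimage_re (Set.Ioo (0:ℝ) 1)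
    rw [this, closure_Ioo (by norm_num)] at hw
    obtain ⟨h1, h2⟩ := hw
    exact ⟨by linarith, by linarith⟩
  have hfd : DiffContOnCl ℂ f (HadamardThreeLines.verticalStrip 0 1) := by
    apply DifferentiableOn.diffContOnCl
    refine DifferentiableOn.mono ?_ hsub
    refine DifferentiableOn.mul ?_ ((hdiff).const_mul _)
    intro w hw
    have : (w + 2) ^ 3 ≠ 0 := by
      apply pow_ne_zero
      have := (sw_norm_w2 hw.1.le).1
      intro h
      rw [h, norm_zero] at this; linarith
    unfold swPhi
    apply DifferentiableAt.differentiableWithinAt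
    refine DifferentiableAt.div ?_ ?_ this <;> fun_prop
  have hfb : BddAbove ((norm ∘ f) '' HadamardThreeLines.verticalClosedStrip 0 1) := by
    refine ⟨‖swcK d‖ * M, ?_⟩
    rintro _ ⟨w, hw, rfl⟩
    have hws : w ∈ swStrip := ⟨by linarith [hw.1], by linarith [hw.2]⟩
    simp only [Function.comp, f, norm_mul]
    have h1 := (swPhi_le hws.1.le).2.2
    have h2 := hM w hws
    calc _ ≤ 1 * (‖swcK d‖ * M) := by gcongr
      _ = _ := one_mul _
  have hleft : ∀ z ∈ re ⁻¹' {(0 : ℝ)}, ‖f z‖ ≤ A := by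
    intro z hz
    have hz0 : z.re = 0 := hz
    by_cases hy : z.im = 0
    · have : z = 0 := Complex.ext hz0 hy
      simp [f, this, swPhi, hA0.le]
    have hzI : z = I * (z.im : ℂ) := by apply Complex.ext <;> simp [hz0]
    have hexp : -1 + (D : ℂ) * z - D = -1 + I * ((D * z.im : ℝ) : ℂ) + -((d : ℂ) + 1) / 2 := by
      conv_lhs => rw [hzI, hDc]
      rw [ofReal_mul, hDc]; ring
    have hn : ∀ H : SwE d → ℂ, ∫⁻ p, ‖H p‖ₑ ^ P ≤ 1 → ∫⁻ p, ‖swPow P H z p‖ₑ ^ 2 ≤ 1 := by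
      intro H hH
      refine le_of_eq_of_le ?_ hH
      congr 1; funext p
      rw [swPow_enorm hP0 H (by rw [hz0]; norm_num), ← ENNReal.rpow_natCast, ← ENNReal.rpow_mul, hz0]
      congr 1; push_cast; ring
    have hb := swT_left ha hab (swPow_nice hP0 hF (w := z) (by rw [hz0]; norm_num) (by rw [hz0]; norm_num))
      (swPow_nice hP0 hG (w := z) (by rw [hz0]; norm_num) (by rw [hz0]; norm_num)) (hn F hF1) (hn G hG1)
      (D * z.im) (mul_ne_zero hD.ne' hy)
    rw [← hexp] at hb
    have hphi := (swPhi_le (w := z) (by rw [hz0]; norm_num)).1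
    have hzn : ‖z‖ = |z.im| := by conv_lhs => rw [hzI]
                                  simp
    rw [hzn] at hphi
    have hl := sw_line_bd (y := z.im) hD hy
    simp only [f]
    rw [norm_mul]
    calc _ ≤ |z.im| / (1 + z.im ^ 2) * ((2 / |D * z.im| + 4 + |D * z.im|) * (2 * (swC2 d).toReal)) := by
          gcongr
      _ = |z.im| / (1 + z.im ^ 2) * (2 / |D * z.im| + 4 + |D * z.im|) * (2 * (swC2 d).toReal) := by ring
      _ ≤ (2 / D + 4 + D) * (2 * (swC2 d).toReal + ‖swcK d‖ + 1) := by
          gcongr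
          linarith [norm_nonneg (swcK d)]
  have hright : ∀ z ∈ re ⁻¹' {(1 : ℝ)}, ‖f z‖ ≤ A := by
    intro z hz
    have hz0 : z.re = 1 := hz
    by_cases hy : z.im = 0
    · have : z = 1 := Complex.ext hz0 hy
      simp [f, this, swPhi, hA0.le]
    have hzI : z = 1 + I * (z.im : ℂ) := by apply Complex.ext <;> simp [hz0]
    have hexp : -1 + (D : ℂ) * z - D = -1 + I * ((D * z.im : ℝ) : ℂ) := by
      conv_lhs => rw [hzI]
      rw [ofReal_mul]; ring
    have hn : ∀ H : SwE d → ℂ, ∫⁻ p, ‖H p‖ₑ ^ P ≤ 1 → ∫⁻ p, ‖swPow P H z p‖ₑ ≤ 1 := by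
      intro H hH
      refine le_of_eq_of_le ?_ hH
      congr 1; funext p
      rw [swPow_enorm hP0 H (by rw [hz0]; norm_num), hz0]
      congr 1; ring
    have hb := swT_right ha hab (swPow_nice hP0 hF (w := z) (by rw [hz0]; norm_num) (by rw [hz0]; norm_num)).int
      (swPow_nice hP0 hG (w := z) (by rw [hz0]; norm_num) (by rw [hz0]; norm_num)).int (hn F hF1) (hn G hG1)
      (D * z.im) (mul_ne_zero hD.ne' hy)
    rw [← hexp] at hb
    have hphi := (swPhi_le (w := z) (by rw [hz0]; norm_num)).2.1
    have hzn : ‖z - 1‖ = |z.im| := by conv_lhs => rw [hzI]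
                                      simp
    rw [hzn] at hphi
    have hl := sw_line_bd (y := z.im) hD hy
    simp only [f]
    rw [norm_mul, norm_mul]
    calc _ ≤ |z.im| / (1 + z.im ^ 2) * (‖swcK d‖ * (2 / |D * z.im| + 4 + |D * z.im|)) := by
          gcongr
      _ = |z.im| / (1 + z.im ^ 2) * (2 / |D * z.im| + 4 + |D * z.im|) * ‖swcK d‖ := by ring
      _ ≤ (2 / D + 4 + D) * (2 * (swC2 d).toReal + ‖swcK d‖ + 1) := by
          gcongr
          have : 0 ≤ (swC2 d).toReal := ENNReal.toReal_nonneg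
          linarith
  set θ : ℂ := 2 / ((d : ℂ) + 1) with hθ
  have hθr : θ = ((2 / ((d : ℝ) + 1) : ℝ) : ℂ) := by rw [hθ]; push_cast; ring
  have hθre : θ.re = 2 / ((d : ℝ) + 1) := by rw [hθr, ofReal_re]
  have hθ0 : 0 < 2 / ((d : ℝ) + 1) := by positivity
  have hθ1 : 2 / ((d : ℝ) + 1) < 1 := by rw [div_lt_one (by positivity)]; linarith
  have h3 := HadamardThreeLines.norm_le_interp_of_mem_verticalClosedStrip₀₁' f (z := θ)
    ⟨by rw [hθre]; exact hθ0.le, by rw [hθre]; exact hθ1.le⟩ hfd hfb hleft hright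
  rw [← Real.rpow_add hA0, sub_add_cancel, Real.rpow_one] at h3
  have hdc : (d : ℂ) + 1 ≠ 0 := by exact_mod_cast (by positivity : (d : ℝ) + 1 ≠ 0)
  have hdc3 : (d : ℂ) + 3 ≠ 0 := by exact_mod_cast (by positivity : (d : ℝ) + 3 ≠ 0)
  have hpw : (P : ℂ) * (1 + θ) / 2 = 1 := by
    rw [hP, hθ]; push_cast; field_simp; ring
  have hex : -1 + (D : ℂ) * θ - D = -((d : ℂ) + 1) / 2 := by
    rw [hDc, hθ]; field_simp; ring
  have hfθ : f θ = swPhi θ * (swcK d * swT a b (-((d : ℂ) + 1) / 2) F G) := by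
    simp only [f]
    rw [swPow_self F hpw, swPow_self G hpw, hex]
  rw [hfθ, norm_mul] at h3
  have hphi : 0 < ‖swPhi θ‖ := by
    rw [norm_pos_iff]
    unfold swPhi
    apply div_ne_zero (mul_ne_zero _ _) (pow_ne_zero _ _)
    · rw [hθr]; exact_mod_cast hθ0.ne'
    · rw [hθr]; rw [sub_ne_zero]; exact_mod_cast hθ1.ne
    · rw [hθr]; exact_mod_cast (by positivity : 2 / ((d : ℝ) + 1) + 2 ≠ 0)
  unfold swCI
  rw [le_div_iff₀ hphi, mul_comm]
  exact h3

lemma swCI_nonneg (d : ℕ) : 0 ≤ swCI d := by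
  unfold swCI; positivity

/-- uniform bound on truncated integrals -/
lemma sw_trunc {d : ℕ} (hd : 2 ≤ d) {a b P : ℝ} (ha : 0 < a) (hab : a ≤ b)
    (hP : P = 2 * ((d : ℝ) + 1) / (d + 3)) {F : SwE d → ℂ}
    (hF : SwNice F) (hF1 : ∫⁻ p, ‖F p‖ₑ ^ P ≤ 1) :
    ‖∫ s in Set.Ioc a b, ∫ k : SwE d, cexp (I * (s * (‖k.1‖ ^ 2 - ‖k.2‖ ^ 2) : ℝ)) *
      ((‖swFT F k‖ ^ 2 : ℝ) : ℂ)‖ ≤ swCI d := by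
  have h := sw_interp hd ha hab hP hF hF.conj hF1 (by simpa [← ofReal_norm] using hF1)
  have e := swT_eq (b := b) ha 0 hF hF.conj
  rw [zero_add] at e
  rw [e] at h
  refine le_of_eq_of_le ?_ h
  congr 1
  apply integral_congr_ae
  filter_upwards with s
  rw [cpow_zero, one_mul]
  congr 1; funext k
  rw [swFT_conj, mul_conj, normSq_eq_norm_sq]

def swSig {d : ℕ} (k : SwE d) : ℝ := ‖k.1‖ ^ 2 - ‖k.2‖ ^ 2

@[fun_prop]
lemma swSig_cont {d : ℕ} : Continuous (swSig (d := d)) := by unfold swSig; fun_prop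

def swphi (N σ : ℝ) : ℝ := ∫ s in (0:ℝ)..N, Real.cos (s * σ)

lemma swphi_ne {σ : ℝ} (hσ : σ ≠ 0) (N : ℝ) : swphi N σ = Real.sin (N * σ) / σ := by
  unfold swphi
  rw [intervalIntegral.integral_comp_mul_right (fun x => Real.cos x) hσ, integral_cos]
  simp; ring

lemma swphi_eq (N σ : ℝ) : swphi N σ = N * Real.sinc (N * σ) := by
  by_cases hσ : σ = 0
  · simp [swphi, hσ]
  rw [swphi_ne hσ]
  by_cases hN : N = 0
  · simp [hN]
  rw [Real.sinc_of_ne_zero (mul_ne_zero hN hσ)]; field_simp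

lemma swphi_cont : Continuous (fun x : ℝ × ℝ => swphi x.1 x.2) := by
  simp_rw [swphi_eq]
  have := Real.continuous_sinc
  fun_prop

lemma swphi_abs {N : ℝ} (hN : 0 ≤ N) (σ : ℝ) : |swphi N σ| ≤ N := by
  rw [swphi_eq, abs_mul, abs_of_nonneg hN]
  have := Real.abs_sinc_le_one (N * σ)
  nlinarith

def swpsi (M σ : ℝ) : ℝ := ∫ N in (0:ℝ)..M, swphi N σ

lemma swphi_cont1 (σ : ℝ) : Continuous (fun N => swphi N σ) :=
  swphi_cont.comp (Continuous.prodMk continuous_id continuous_const)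

lemma swpsi_nonneg {M : ℝ} (hM : 0 ≤ M) (σ : ℝ) : 0 ≤ swpsi M σ := by
  by_cases hσ : σ = 0
  · unfold swpsi
    apply intervalIntegral.integral_nonneg hM
    intro u hu
    simp [swphi, hσ, hu.1]
  · unfold swpsi
    simp_rw [swphi_ne hσ]
    rw [intervalIntegral.integral_div, intervalIntegral.integral_comp_mul_right (fun x => Real.sin x) hσ,
      integral_sin]
    have : σ⁻¹ • (Real.cos (0 * σ) - Real.cos (M * σ)) / σ = (1 - Real.cos (M * σ)) / σ ^ 2 := by
      simp; field_simp
    rw [this]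
    have := Real.cos_le_one (M * σ)
    apply div_nonneg <;> nlinarith [sq_nonneg σ]

lemma swpsi_ge {M σ : ℝ} (hM : 0 < M) (hσ : |σ| ≤ 1 / M) : M ^ 2 / 4 ≤ swpsi M σ := by
  have h1 : ∀ N ∈ Set.Icc 0 M, N / 2 ≤ swphi N σ := by
    intro N hN
    unfold swphi
    have : N / 2 = ∫ s in (0:ℝ)..N, (1 / 2 : ℝ) := by simp; ring
    rw [this]
    apply intervalIntegral.integral_mono_on hN.1 (by simp)
    · exact (by fun_prop : Continuous fun s => Real.cos (s * σ)).intervalIntegrable _ _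
    · intro s hs
      have h2 := Real.one_sub_sq_div_two_le_cos (x := s * σ)
      have h3 : |s * σ| ≤ 1 := by
        rw [abs_mul, abs_of_nonneg hs.1]
        calc s * |σ| ≤ M * (1 / M) := by
              apply mul_le_mul (hs.2.trans hN.2) hσ (abs_nonneg _) hM.le
          _ = 1 := by field_simp
      have h4 : (s * σ) ^ 2 ≤ 1 := by rw [← sq_abs]; nlinarith [abs_nonneg (s * σ)]
      linarith
  unfold swpsi
  have : M ^ 2 / 4 = ∫ N in (0:ℝ)..M, N / 2 := by
    rw [intervalIntegral.integral_div, integral_id]; ring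
  rw [this]
  apply intervalIntegral.integral_mono_on hM.le _ _ h1
  · exact (by fun_prop : Continuous fun N : ℝ => N / 2).intervalIntegrable _ _
  · exact (swphi_cont1 σ).intervalIntegrable _ _

lemma sw_sq_int {d : ℕ} {F : SwE d → ℂ} (hF : SwNice F) : Integrable (fun k => ‖swFT F k‖ ^ 2) := by
  refine ((sw_prod_int hF hF.conj).norm).congr ?_
  filter_upwards with k
  rw [swFT_conj, mul_conj, normSq_eq_norm_sq, norm_real]
  simp

/-- swap integral against bounded continuous kernel -/
lemma sw_swap {d : ℕ} {h : SwE d → ℝ} (hh : Integrable h) {g : ℝ → ℝ → ℝ} {N B : ℝ}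
    (hg : Continuous (fun x : ℝ × ℝ => g x.1 x.2)) (hB : ∀ s ∈ Set.Ioc 0 N, ∀ σ, |g s σ| ≤ B) :
    (∫ s in Set.Ioc 0 N, ∫ k, g s (swSig k) * h k) = ∫ k, (∫ s in Set.Ioc 0 N, g s (swSig k)) * h k := by
  rw [integral_integral_swap]
  · simp_rw [integral_mul_const]
  · have h0 : Integrable (fun x : ℝ × SwE d => B * h x.2)
        ((volume.restrict (Set.Ioc 0 N)).prod volume) := by
      have : Integrable (fun _ : ℝ => B) (volume.restrict (Set.Ioc 0 N)) := integrableOn_const (by simp)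
      exact this.mul_prod hh
    have hmem : ∀ᵐ x ∂((volume.restrict (Set.Ioc 0 N)).prod (volume : Measure (SwE d))),
        x.1 ∈ Set.Ioc 0 N :=
      Measure.quasiMeasurePreserving_fst.ae (ae_restrict_mem measurableSet_Ioc)
    refine h0.mono ?_ ?_
    · refine AEStronglyMeasurable.mul ?_ hh.1.comp_snd
      exact (hg.comp (continuous_fst.prodMk (swSig_cont.comp continuous_snd))).aestronglyMeasurable
    · filter_upwards [hmem] with x hx
      simp only [Function.uncurry, norm_mul, Real.norm_eq_abs]
      exact mul_le_mul_of_nonneg_right ((hB _ hx _).trans (le_abs_self B)) (abs_nonneg _)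

lemma sw_real_bd {d : ℕ} (hd : 2 ≤ d) {N P : ℝ} (hN : 0 < N)
    (hP : P = 2 * ((d : ℝ) + 1) / (d + 3)) {F : SwE d → ℂ}
    (hF : SwNice F) (hF1 : ∫⁻ p, ‖F p‖ₑ ^ P ≤ 1) :
    ∫ k : SwE d, swphi N (swSig k) * ‖swFT F k‖ ^ 2 ≤ swCI d := by
  have hh := sw_sq_int hF
  set H : ℝ := ∫ k : SwE d, ‖swFT F k‖ ^ 2 with hH
  have hH0 : 0 ≤ H := integral_nonneg (fun k => by positivity)
  let Q : ℝ → ℝ := fun s => ∫ k : SwE d, Real.cos (s * swSig k) * ‖swFT F k‖ ^ 2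
  have hQb : ∀ s, |Q s| ≤ H := by
    intro s
    rw [← Real.norm_eq_abs]
    refine norm_integral_le_of_norm_le hh ?_
    filter_upwards with k
    rw [norm_mul, Real.norm_eq_abs, Real.norm_of_nonneg (by positivity : 0 ≤ ‖swFT F k‖ ^ 2)]
    have := Real.abs_cos_le_one (s * swSig k)
    nlinarith [sq_nonneg ‖swFT F k‖]
  have hQc : Continuous Q := by
    refine continuous_of_dominated (bound := fun k => ‖swFT F k‖ ^ 2) ?_ ?_ hh ?_
    · intro s
      refine AEStronglyMeasurable.mul ?_ hh.1
      exact (by fun_prop : Continuous fun k : SwE d => Real.cos (s * swSig k)).aestronglyMeasurable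
    · intro s
      filter_upwards with k
      rw [norm_mul, Real.norm_eq_abs, Real.norm_of_nonneg (by positivity : 0 ≤ ‖swFT F k‖ ^ 2)]
      have := Real.abs_cos_le_one (s * swSig k)
      nlinarith [sq_nonneg ‖swFT F k‖]
    · filter_upwards with k
      fun_prop
  have hsw := sw_swap hh (g := fun s σ => Real.cos (s * σ)) (N := N) (B := 1) (by fun_prop)
    (fun s _ σ => Real.abs_cos_le_one _)
  have e1 : ∫ k : SwE d, swphi N (swSig k) * ‖swFT F k‖ ^ 2 = ∫ s in (0:ℝ)..N, Q s := by
    rw [intervalIntegral.integral_of_le hN.le]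
    rw [hsw]
    simp_rw [swphi, intervalIntegral.integral_of_le hN.le]
  rw [e1]
  have key : ∀ a ∈ Set.Ioc 0 N, ∫ s in a..N, Q s ≤ swCI d := by
    intro a ha
    have h := sw_trunc hd ha.1 ha.2 hP hF hF1
    refine le_trans ?_ ((re_le_norm _).trans h)
    rw [intervalIntegral.integral_of_le ha.2]
    apply le_of_eq
    have hcint : ∀ s : ℝ, Integrable (fun k : SwE d => cexp (I * (s * (‖k.1‖ ^ 2 - ‖k.2‖ ^ 2) : ℝ)) *
      ((‖swFT F k‖ ^ 2 : ℝ) : ℂ)) := by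
      intro s
      refine sw_int_phase (hh.ofReal) (φ := fun k : SwE d => s * (‖k.1‖ ^ 2 - ‖k.2‖ ^ 2)) ?_
      apply Continuous.aestronglyMeasurable
      fun_prop
    have hQc' : Continuous (fun s : ℝ => ∫ k : SwE d, cexp (I * (s * (‖k.1‖ ^ 2 - ‖k.2‖ ^ 2) : ℝ)) *
      ((‖swFT F k‖ ^ 2 : ℝ) : ℂ)) := by
      refine continuous_of_dominated (bound := fun k => ‖swFT F k‖ ^ 2) (fun s => (hcint s).1) ?_ hh ?_
      · intro s
        filter_upwards with k
        rw [norm_mul, sw_norm_exp, norm_real, one_mul, Real.norm_of_nonneg (by positivity)]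
      · filter_upwards with k
        fun_prop
    have hI : IntegrableOn (fun s : ℝ => ∫ k : SwE d, cexp (I * (s * (‖k.1‖ ^ 2 - ‖k.2‖ ^ 2) : ℝ)) *
      ((‖swFT F k‖ ^ 2 : ℝ) : ℂ)) (Set.Ioc a N) :=
      (hQc'.continuousOn.integrableOn_Icc).mono_set Set.Ioc_subset_Icc_self
    have hre := reCLM.integral_comp_comm hI
    simp only [reCLM_apply] at hre
    rw [← hre]
    congr 1
    funext s
    have hre2 := reCLM.integral_comp_comm (hcint s)
    simp only [reCLM_apply] at hre2
    rw [← hre2]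
    simp only [Q]
    congr 1
    funext k
    rw [re_mul_ofReal, mul_comm I, exp_ofReal_mul_I_re]
    rfl
  apply le_of_forall_pos_le_add
  intro ε hε
  set a : ℝ := min N (ε / (H + 1)) with ha
  have ha0 : 0 < a := lt_min hN (by positivity)
  have h1 := key a ⟨ha0, min_le_left _ _⟩
  have h2 : ∫ s in (0:ℝ)..a, Q s ≤ ε := by
    have : ‖∫ s in (0:ℝ)..a, Q s‖ ≤ H * |a - 0| :=
      intervalIntegral.norm_integral_le_of_norm_le_const (fun s _ => hQb s)
    rw [sub_zero, abs_of_pos ha0] at this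
    calc _ ≤ H * a := (le_abs_self _).trans this
      _ ≤ H * (ε / (H + 1)) := by gcongr; exact min_le_right _ _
      _ ≤ ε := by rw [mul_div_assoc', div_le_iff₀ (by positivity)]; nlinarith
  rw [← intervalIntegral.integral_add_adjacent_intervals (hQc.intervalIntegrable 0 a)
    (hQc.intervalIntegrable a N)]
  linarith

lemma sw_psi_bd {d : ℕ} (hd : 2 ≤ d) {M P : ℝ} (hM : 0 < M)
    (hP : P = 2 * ((d : ℝ) + 1) / (d + 3)) {F : SwE d → ℂ}
    (hF : SwNice F) (hF1 : ∫⁻ p, ‖F p‖ₑ ^ P ≤ 1) :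
    ∫ k : SwE d, swpsi M (swSig k) * ‖swFT F k‖ ^ 2 ≤ swCI d * M := by
  have hsw := sw_swap (sw_sq_int hF) (g := swphi) (N := M) (B := M) swphi_cont
    (fun s hs σ => (swphi_abs hs.1.le σ).trans hs.2)
  simp_rw [swpsi, intervalIntegral.integral_of_le hM.le]
  rw [← hsw]
  have hC := swCI_nonneg d
  have : swCI d * M = ∫ s in Set.Ioc 0 M, swCI d := by simp [hM.le, mul_comm]
  rw [this]
  by_cases hint : IntegrableOn (fun s => ∫ k : SwE d, swphi s (swSig k) * ‖swFT F k‖ ^ 2) (Set.Ioc 0 M)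
  · apply setIntegral_mono_on hint (integrableOn_const (by simp)) measurableSet_Ioc
    intro s hs
    exact sw_real_bd hd hs.1 hP hF hF1
  · rw [integral_undef hint]
    exact integral_nonneg (fun _ => hC)

lemma swpsi_meas (M : ℝ) : Continuous (swpsi M) := by
  unfold swpsi
  apply intervalIntegral.continuous_parametric_intervalIntegral_of_continuous' (f := fun σ N => swphi N σ)
  exact swphi_cont.comp continuous_swap

lemma swpsi_le {M : ℝ} (hM : 0 ≤ M) (σ : ℝ) : |swpsi M σ| ≤ M * M := by
  have : ‖∫ N in (0:ℝ)..M, swphi N σ‖ ≤ M * |M - 0| :=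
    intervalIntegral.norm_integral_le_of_norm_le_const (fun s hs => by
      rw [Set.uIoc_of_le hM] at hs
      exact (swphi_abs hs.1.le σ).trans hs.2)
  rw [sub_zero, abs_of_nonneg hM] at this
  exact this

lemma sw_slab {d : ℕ} (hd : 2 ≤ d) {M P : ℝ} (hM : 0 < M)
    (hP : P = 2 * ((d : ℝ) + 1) / (d + 3)) {F : SwE d → ℂ}
    (hF : SwNice F) (hF1 : ∫⁻ p, ‖F p‖ₑ ^ P ≤ 1) :
    ENNReal.ofReal M * ∫⁻ k : SwE d, {k | |swSig k| ≤ 1 / M}.indicator (fun k => ‖swFT F k‖ₑ ^ 2) k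
      ≤ ENNReal.ofReal (4 * swCI d) := by
  have h := sw_psi_bd hd hM hP hF hF1
  have hh := sw_sq_int hF
  have hint : Integrable (fun k : SwE d => swpsi M (swSig k) * ‖swFT F k‖ ^ 2) := by
    refine hh.bdd_mul (c := M * M) ((swpsi_meas M).comp swSig_cont).aestronglyMeasurable ?_
    filter_upwards with k using swpsi_le hM.le _
  have hl := ofReal_integral_eq_lintegral_ofReal hint
    (by filter_upwards with k; exact mul_nonneg (swpsi_nonneg hM.le _) (by positivity))
  have h2 : ENNReal.ofReal (M ^ 2 / 4) * ∫⁻ k : SwE d, {k | |swSig k| ≤ 1 / M}.indicator (fun k => ‖swFT F k‖ₑ ^ 2) k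
      ≤ ENNReal.ofReal (swCI d * M) := by
    refine le_trans ?_ (ENNReal.ofReal_le_ofReal h)
    rw [hl, ← lintegral_const_mul' _ _ ENNReal.ofReal_ne_top]
    apply lintegral_mono
    intro k
    by_cases hk : |swSig k| ≤ 1 / M
    · simp only
      rw [Set.indicator_of_mem (by exact hk), ENNReal.ofReal_mul (swpsi_nonneg hM.le _),
        ENNReal.ofReal_pow (norm_nonneg _), ofReal_norm]
      gcongr
      exact swpsi_ge hM hk
    · simp only
      rw [Set.indicator_of_notMem (by exact hk)]
      simp
  have e1 : ENNReal.ofReal M = ENNReal.ofReal (4 / M) * ENNReal.ofReal (M ^ 2 / 4) := by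
    rw [← ENNReal.ofReal_mul (by positivity)]; congr 1; field_simp
  have e2 : ENNReal.ofReal (4 * swCI d) = ENNReal.ofReal (4 / M) * ENNReal.ofReal (swCI d * M) := by
    rw [← ENNReal.ofReal_mul (by positivity)]; congr 1; field_simp
  rw [e1, e2, mul_assoc]
  gcongr

lemma sw_cone {d : ℕ} (hd : 2 ≤ d) {P : ℝ}
    (hP : P = 2 * ((d : ℝ) + 1) / (d + 3)) {F : SwE d → ℂ}
    (hF : SwNice F) (hF1 : ∫⁻ p, ‖F p‖ₑ ^ P ≤ 1) :
    ∫⁻ ξ : EuclideanSpace ℝ (Fin d), ENNReal.ofReal (1 / (3 * ‖ξ‖)) * ‖swFT F (‖ξ‖, ξ)‖ₑ ^ 2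
      ≤ ENNReal.ofReal (4 * swCI d) := by
  have hc := swFT_cont hF.int
  let A : ℕ → SwE d → ℝ≥0∞ := fun n => {k | |swSig k| ≤ 1 / ((n : ℝ) + 1)}.indicator (fun k => ‖swFT F k‖ₑ ^ 2)
  have hAm : ∀ n, Measurable (A n) := by
    intro n
    refine Measurable.indicator (by fun_prop) ?_
    exact measurableSet_le (swSig_cont.abs.measurable) measurable_const
  let g : ℕ → EuclideanSpace ℝ (Fin d) → ℝ≥0∞ := fun n ξ => ENNReal.ofReal ((n : ℝ) + 1) * ∫⁻ τ : ℝ, A n (τ, ξ)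
  have hgm : ∀ n, Measurable (g n) := fun n => (Measurable.lintegral_prod_left' (hAm n)).const_mul _
  have hgi : ∀ n, ∫⁻ ξ, g n ξ ≤ ENNReal.ofReal (4 * swCI d) := by
    intro n
    have := sw_slab hd (M := (n : ℝ) + 1) (by positivity) hP hF hF1
    simp only [g]
    rw [lintegral_const_mul' _ _ ENNReal.ofReal_ne_top]
    rw [Measure.volume_eq_prod, lintegral_prod_symm _ (hAm n).aemeasurable] at this
    exact this
  calc _ ≤ ∫⁻ ξ, Filter.liminf (fun n => g n ξ) Filter.atTop := by
        apply lintegral_mono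
        intro ξ
        by_cases hξ : ξ = 0
        · simp [hξ]
        have hr : 0 < ‖ξ‖ := norm_pos_iff.2 hξ
        apply ENNReal.mul_le_of_forall_lt
        intro a' ha' c hc'
        refine le_trans ?_ (Filter.le_liminf_of_le (a := ENNReal.ofReal (1 / (3 * ‖ξ‖)) * c) (by isBoundedDefault) ?_)
        · gcongr
        have hcont : Continuous (fun τ : ℝ => ‖swFT F (τ, ξ)‖ₑ ^ 2) := by fun_prop
        have hev : ∀ᶠ τ in nhds ‖ξ‖, c < ‖swFT F (τ, ξ)‖ₑ ^ 2 := hcont.continuousAt.eventually_const_lt hc'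
        obtain ⟨δ, hδ, hball⟩ := Metric.eventually_nhds_iff.1 hev
        have hlim : Filter.Tendsto (fun n : ℕ => 1 / ((n : ℝ) + 1) * (1 / (3 * ‖ξ‖))) Filter.atTop (nhds 0) := by
          simpa using tendsto_one_div_add_atTop_nhds_zero_nat.mul_const (1 / (3 * ‖ξ‖))
        filter_upwards [hlim.eventually_lt_const hδ, hlim.eventually_lt_const hr] with n hn1 hn2
        set η := 1 / ((n : ℝ) + 1) * (1 / (3 * ‖ξ‖)) with hη
        have hη0 : 0 < η := by positivity
        have hle : c * ENNReal.ofReal η ≤ ∫⁻ τ : ℝ, A n (τ, ξ) := by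
          calc c * ENNReal.ofReal η = ∫⁻ τ in Set.Icc ‖ξ‖ (‖ξ‖ + η), c := by simp
            _ ≤ ∫⁻ τ in Set.Icc ‖ξ‖ (‖ξ‖ + η), A n (τ, ξ) := by
                apply setLIntegral_mono' measurableSet_Icc
                intro τ hτ
                have hs : (τ, ξ) ∈ {k : SwE d | |swSig k| ≤ 1 / ((n : ℝ) + 1)} := by
                  simp only [Set.mem_ofPred_eq, swSig, Real.norm_eq_abs, sq_abs]
                  have e : 1 / ((n : ℝ) + 1) = η * (3 * ‖ξ‖) := by rw [hη]; field_simp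
                  rw [e, abs_of_nonneg (by nlinarith [hτ.1])]
                  nlinarith [hτ.1, hτ.2]
                simp only [A]
                rw [Set.indicator_of_mem hs]
                refine (hball ?_).le
                rw [Real.dist_eq, abs_lt]
                constructor <;> linarith [hτ.1, hτ.2]
            _ ≤ _ := setLIntegral_le_lintegral _ _
        simp only [g]
        calc ENNReal.ofReal (1 / (3 * ‖ξ‖)) * c = ENNReal.ofReal ((n : ℝ) + 1) * (c * ENNReal.ofReal η) := by
              rw [mul_comm c, ← mul_assoc, ← ENNReal.ofReal_mul (by positivity)]
              congr 2; rw [hη]; field_simp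
          _ ≤ _ := by gcongr
    _ ≤ Filter.liminf (fun n => ∫⁻ ξ, g n ξ) Filter.atTop := lintegral_liminf_le hgm
    _ ≤ _ := by
        refine Filter.liminf_le_of_frequently_le' ?_
        exact Filter.Frequently.of_forall hgi

def swEx {d : ℕ} (γ : EuclideanSpace ℝ (Fin d) → ℂ) (p : SwE d) : ℂ :=
  ∫ ξ, cexp (I * (swPr p (‖ξ‖, ξ) : ℝ)) * γ ξ

lemma swEx_cont {d : ℕ} {γ : EuclideanSpace ℝ (Fin d) → ℂ} (hγ : Integrable γ) :
    Continuous (swEx γ) := by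
  refine continuous_of_dominated (bound := fun ξ => ‖γ ξ‖) ?_ ?_ hγ.norm ?_
  · intro p
    refine (sw_int_phase hγ (φ := fun ξ => swPr p (‖ξ‖, ξ)) ?_).1
    exact (by unfold swPr; fun_prop : Continuous fun ξ : EuclideanSpace ℝ (Fin d) => swPr p (‖ξ‖, ξ)).aestronglyMeasurable
  · intro p
    filter_upwards with ξ
    rw [norm_mul, sw_norm_exp, one_mul]
  · filter_upwards with ξ
    unfold swPr
    fun_prop

lemma swEx_bdd {d : ℕ} {γ : EuclideanSpace ℝ (Fin d) → ℂ} (hγ : Integrable γ) (p : SwE d) :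
    ‖swEx γ p‖ ≤ ∫ ξ, ‖γ ξ‖ := by
  refine norm_integral_le_of_norm_le hγ.norm ?_
  filter_upwards with ξ
  rw [norm_mul, sw_norm_exp, one_mul]

lemma sw_dual_eq {d : ℕ} {γ : EuclideanSpace ℝ (Fin d) → ℂ} (hγ : Integrable γ) {F : SwE d → ℂ}
    (hF : Integrable F) : ∫ p, swEx γ p * F p = ∫ ξ, γ ξ * swFT F (‖ξ‖, ξ) := by
  have hint : Integrable (fun x : SwE d × EuclideanSpace ℝ (Fin d) =>
      cexp (I * (swPr x.1 (‖x.2‖, x.2) : ℝ)) * (F x.1 * γ x.2)) (volume.prod volume) := by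
    refine sw_int_phase (hF.mul_prod hγ) (φ := fun x => swPr x.1 (‖x.2‖, x.2)) ?_
    exact (by unfold swPr; fun_prop : Continuous fun x : SwE d × EuclideanSpace ℝ (Fin d) =>
      swPr x.1 (‖x.2‖, x.2)).aestronglyMeasurable
  calc ∫ p, swEx γ p * F p = ∫ p, ∫ ξ, cexp (I * (swPr p (‖ξ‖, ξ) : ℝ)) * (F p * γ ξ) := by
        congr 1; funext p
        unfold swEx
        rw [← integral_mul_const]
        congr 1; funext ξ; ring
    _ = ∫ ξ, ∫ p, cexp (I * (swPr p (‖ξ‖, ξ) : ℝ)) * (F p * γ ξ) := integral_integral_swap hint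
    _ = _ := by
        congr 1; funext ξ
        unfold swFT
        rw [← integral_const_mul]
        congr 1; funext p; ring

lemma sw_ae_ne {d : ℕ} (hd : 2 ≤ d) : ∀ᵐ ξ : EuclideanSpace ℝ (Fin d), ξ ≠ 0 := by
  have : Nonempty (Fin d) := ⟨⟨0, by omega⟩⟩
  have : Nontrivial (EuclideanSpace ℝ (Fin d)) := inferInstance
  exact Measure.ae_ne volume 0

def swK4 (d : ℕ) : ℝ≥0∞ := ENNReal.ofReal (4 * swCI d)

lemma sw_dual_le {d : ℕ} (hd : 2 ≤ d) {P : ℝ}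
    (hP : P = 2 * ((d : ℝ) + 1) / (d + 3)) {γ : EuclideanSpace ℝ (Fin d) → ℂ} (hγ : Integrable γ)
    {F : SwE d → ℂ} (hF : SwNice F) (hF1 : ∫⁻ p, ‖F p‖ₑ ^ P ≤ 1) :
    ‖∫ p, swEx γ p * F p‖ₑ ≤
      (∫⁻ ξ, ENNReal.ofReal (3 * ‖ξ‖) * ‖γ ξ‖ₑ ^ 2) ^ (1 / 2 : ℝ) * (swK4 d) ^ (1 / 2 : ℝ) := by
  rw [sw_dual_eq hγ hF.int]
  refine (enorm_integral_le_lintegral_enorm _).trans ?_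
  have hc := swFT_cont hF.int
  have hg : Continuous (fun ξ : EuclideanSpace ℝ (Fin d) => swFT F (‖ξ‖, ξ)) := by fun_prop
  let f1 : EuclideanSpace ℝ (Fin d) → ℝ≥0∞ := fun ξ => ENNReal.ofReal (Real.sqrt (3 * ‖ξ‖)) * ‖γ ξ‖ₑ
  let f2 : EuclideanSpace ℝ (Fin d) → ℝ≥0∞ := fun ξ => ENNReal.ofReal (Real.sqrt (1 / (3 * ‖ξ‖))) * ‖swFT F (‖ξ‖, ξ)‖ₑ
  have hm1 : AEMeasurable f1 := by
    refine AEMeasurable.mul ?_ hγ.1.enorm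
    fun_prop
  have hm2 : AEMeasurable f2 := by
    refine AEMeasurable.mul ?_ (hg.enorm.measurable.aemeasurable)
    fun_prop
  have hH := ENNReal.lintegral_mul_le_Lp_mul_Lq volume Real.HolderConjugate.two_two hm1 hm2
  have e1 : ∀ ξ, f1 ξ ^ (2 : ℝ) = ENNReal.ofReal (3 * ‖ξ‖) * ‖γ ξ‖ₑ ^ 2 := by
    intro ξ
    simp only [f1]
    rw [ENNReal.rpow_two, mul_pow, ← ENNReal.ofReal_pow (by positivity), Real.sq_sqrt (by positivity)]
  have e2 : ∀ ξ, f2 ξ ^ (2 : ℝ) = ENNReal.ofReal (1 / (3 * ‖ξ‖)) * ‖swFT F (‖ξ‖, ξ)‖ₑ ^ 2 := by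
    intro ξ
    simp only [f2]
    rw [ENNReal.rpow_two, mul_pow, ← ENNReal.ofReal_pow (by positivity), Real.sq_sqrt (by positivity)]
  simp_rw [e1, e2] at hH
  calc ∫⁻ ξ, ‖γ ξ * swFT F (‖ξ‖, ξ)‖ₑ = ∫⁻ ξ, (f1 * f2) ξ := by
        apply lintegral_congr_ae
        filter_upwards [sw_ae_ne hd] with ξ hξ
        have hr : 0 < ‖ξ‖ := norm_pos_iff.2 hξ
        simp only [Pi.mul_apply, f1, f2]
        rw [mul_mul_mul_comm, ← ENNReal.ofReal_mul (by positivity), ← Real.sqrt_mul (by positivity),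
          mul_one_div_cancel (by positivity), Real.sqrt_one, ENNReal.ofReal_one, one_mul, enorm_mul]
    _ ≤ _ := hH
    _ ≤ _ := by
        gcongr
        exact sw_cone hd hP hF hF1

lemma sw_ball {d : ℕ} (hd : 2 ≤ d) {q : ℝ} (hq : q = 2 * ((d : ℝ) + 1) / (d - 1))
    {γ : EuclideanSpace ℝ (Fin d) → ℂ} (hγ : Integrable γ) (R : ℝ) :
    (∫⁻ p in Metric.ball (0 : SwE d) R, ‖swEx γ p‖ₑ ^ q) ^ (1 / q) ≤
      (∫⁻ ξ, ENNReal.ofReal (3 * ‖ξ‖) * ‖γ ξ‖ₑ ^ 2) ^ (1 / 2 : ℝ) * (swK4 d) ^ (1 / 2 : ℝ) := by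
  have hd' : (2 : ℝ) ≤ d := by exact_mod_cast hd
  have hd1 : (0 : ℝ) < (d : ℝ) - 1 := by linarith
  set P : ℝ := 2 * ((d : ℝ) + 1) / (d + 3) with hP
  have hP0 : 0 < P := by positivity
  have hq0 : 0 < q := by rw [hq]; positivity
  have hq2 : 0 < q - 2 := by
    have : q - 2 = 4 / ((d : ℝ) - 1) := by rw [hq]; field_simp; ring
    rw [this]; positivity
  have hqP : (q - 1) * P = q := by rw [hq, hP]; field_simp; ring
  have hqP' : 1 - 1 / P = 1 / q := by rw [hq, hP]; field_simp; ring
  set N := ∫⁻ p in Metric.ball (0 : SwE d) R, ‖swEx γ p‖ₑ ^ q with hN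
  have hball : volume (Metric.ball (0 : SwE d) R) < ∞ := measure_ball_lt_top
  have hcont := swEx_cont hγ
  set B0 := ∫ ξ, ‖γ ξ‖ with hB0
  have hB00 : 0 ≤ B0 := integral_nonneg (fun _ => norm_nonneg _)
  have hNtop : N ≠ ∞ := by
    have : N ≤ ENNReal.ofReal B0 ^ q * volume (Metric.ball (0 : SwE d) R) := by
      rw [hN, ← setLIntegral_const]
      apply lintegral_mono
      intro p
      simp only
      gcongr
      rw [← ofReal_norm]
      exact ENNReal.ofReal_le_ofReal (swEx_bdd hγ p)
    refine (this.trans_lt (ENNReal.mul_lt_top ?_ hball)).ne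
    exact ENNReal.rpow_lt_top_of_nonneg hq0.le ENNReal.ofReal_ne_top
  by_cases hN0 : N = 0
  · rw [hN0, ENNReal.zero_rpow_of_pos (by positivity)]; simp
  set n := N.toReal with hn
  have hn0 : 0 < n := ENNReal.toReal_pos hN0 hNtop
  have hnN : ENNReal.ofReal n = N := ENNReal.ofReal_toReal hNtop
  set κ : ℝ := n ^ (-(1 / P)) with hκ
  have hκ0 : 0 < κ := Real.rpow_pos_of_pos hn0 _
  have hκN : ENNReal.ofReal κ = N ^ (-(1 / P)) := by
    rw [hκ, ← ENNReal.ofReal_rpow_of_pos hn0, hnN]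
  let F : SwE d → ℂ := (Metric.ball (0 : SwE d) R).indicator
    (fun p => (starRingEnd ℂ) (swEx γ p) * ((‖swEx γ p‖ ^ (q - 2) * κ : ℝ) : ℂ))
  have hFnorm : ∀ p ∈ Metric.ball (0 : SwE d) R, ‖F p‖ = ‖swEx γ p‖ ^ (q - 1) * κ := by
    intro p hp
    simp only [F]
    rw [Set.indicator_of_mem hp, norm_mul, RCLike.norm_conj, norm_real, Real.norm_of_nonneg (by positivity),
      ← mul_assoc]
    congr 1
    have : q - 1 = 1 + (q - 2) := by ring
    rw [this, Real.rpow_add_of_nonneg (norm_nonneg _) (by norm_num) hq2.le, Real.rpow_one]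
  have hFnice : SwNice F := by
    refine ⟨?_, ⟨B0 ^ (q - 1) * κ, ?_⟩, Metric.ball 0 R, measurableSet_ball, hball, ?_⟩
    · refine Measurable.indicator ?_ measurableSet_ball
      refine (continuous_conj.comp hcont).measurable.mul ?_
      refine measurable_ofReal.comp ?_
      exact (hcont.norm.measurable.pow_const _).mul_const _
    · intro p
      by_cases hp : p ∈ Metric.ball (0 : SwE d) R
      · rw [hFnorm p hp]
        gcongr
        · linarith
        · exact swEx_bdd hγ p
      · simp only [F]; rw [Set.indicator_of_notMem hp, norm_zero]; positivity
    · intro p hp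
      simp only [F]; rw [Set.indicator_of_notMem hp]
  have hF1 : ∫⁻ p, ‖F p‖ₑ ^ P ≤ 1 := by
    have : ∀ p, ‖F p‖ₑ ^ P = (Metric.ball (0 : SwE d) R).indicator (fun p => N⁻¹ * ‖swEx γ p‖ₑ ^ q) p := by
      intro p
      by_cases hp : p ∈ Metric.ball (0 : SwE d) R
      · rw [Set.indicator_of_mem hp, ← ofReal_norm, hFnorm p hp, ENNReal.ofReal_mul (by positivity),
          ENNReal.mul_rpow_of_nonneg _ _ hP0.le, hκN, ← ENNReal.rpow_mul,
          ← ENNReal.ofReal_rpow_of_nonneg (norm_nonneg _) (by linarith), ← ENNReal.rpow_mul, hqP, ofReal_norm,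
          mul_comm]
        congr 1
        rw [neg_mul, one_div_mul_cancel hP0.ne', ENNReal.rpow_neg_one]
      · simp only [F]
        rw [Set.indicator_of_notMem hp, Set.indicator_of_notMem hp, enorm_zero, ENNReal.zero_rpow_of_pos hP0]
    simp_rw [this]
    rw [lintegral_indicator measurableSet_ball, lintegral_const_mul' _ _ (ENNReal.inv_ne_top.2 hN0), ← hN,
      ENNReal.inv_mul_cancel hN0 hNtop]
  have hmain := sw_dual_le hd hP hγ hFnice hF1
  refine le_of_eq_of_le ?_ hmain
  have hprod : ∀ p, swEx γ p * F p =
      (((Metric.ball (0 : SwE d) R).indicator (fun p => ‖swEx γ p‖ ^ q * κ) p : ℝ) : ℂ) := by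
    intro p
    by_cases hp : p ∈ Metric.ball (0 : SwE d) R
    · simp only [F]
      rw [Set.indicator_of_mem hp, Set.indicator_of_mem hp, ← mul_assoc, mul_conj, normSq_eq_norm_sq,
        ← ofReal_mul, ← mul_assoc]
      congr 2
      have : q = 2 + (q - 2) := by ring
      conv_rhs => rw [this, Real.rpow_add_of_nonneg (norm_nonneg _) (by norm_num) hq2.le, Real.rpow_two]
    · simp only [F]
      rw [Set.indicator_of_notMem hp, Set.indicator_of_notMem hp]; simp
  simp_rw [hprod]
  have hnn : ∀ p, 0 ≤ (Metric.ball (0 : SwE d) R).indicator (fun p => ‖swEx γ p‖ ^ q * κ) p :=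
    fun p => Set.indicator_nonneg (fun p _ => by positivity) p
  rw [integral_complex_ofReal, ← ofReal_norm, norm_real, Real.norm_of_nonneg (integral_nonneg hnn)]
  have hmeas : Measurable (fun p => (Metric.ball (0 : SwE d) R).indicator (fun p => ‖swEx γ p‖ ^ q * κ) p) := by
    refine Measurable.indicator ?_ measurableSet_ball
    exact (hcont.norm.measurable.pow_const _).mul_const _
  rw [integral_eq_lintegral_of_nonneg_ae (Filter.Eventually.of_forall hnn) hmeas.aestronglyMeasurable]
  have e3 : ∫⁻ p, ENNReal.ofReal ((Metric.ball (0 : SwE d) R).indicator (fun p => ‖swEx γ p‖ ^ q * κ) p)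
      = N ^ (1 / q) := by
    have : ∀ p, ENNReal.ofReal ((Metric.ball (0 : SwE d) R).indicator (fun p => ‖swEx γ p‖ ^ q * κ) p) =
        (Metric.ball (0 : SwE d) R).indicator (fun p => N ^ (-(1 / P)) * ‖swEx γ p‖ₑ ^ q) p := by
      intro p
      by_cases hp : p ∈ Metric.ball (0 : SwE d) R
      · rw [Set.indicator_of_mem hp, Set.indicator_of_mem hp, ENNReal.ofReal_mul (by positivity),
          ← ENNReal.ofReal_rpow_of_nonneg (norm_nonneg _) hq0.le, ofReal_norm, hκN, mul_comm]
      · rw [Set.indicator_of_notMem hp, Set.indicator_of_notMem hp, ENNReal.ofReal_zero]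
    simp_rw [this]
    rw [lintegral_indicator measurableSet_ball, lintegral_const_mul' _ _ (by rw [← hκN]; exact ENNReal.ofReal_ne_top), ← hN]
    conv_lhs => rw [← ENNReal.rpow_one N]
    rw [← ENNReal.rpow_mul, ← ENNReal.rpow_add _ _ hN0 hNtop, ← hqP']
    congr 1; ring
  rw [e3, ENNReal.ofReal_toReal]
  exact ENNReal.rpow_ne_top_of_nonneg (by positivity) hNtop

lemma sw_ext {d : ℕ} (hd : 2 ≤ d) {q : ℝ} (hq : q = 2 * ((d : ℝ) + 1) / (d - 1))
    {γ : EuclideanSpace ℝ (Fin d) → ℂ} (hγ : Integrable γ) :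
    eLpNorm (swEx γ) (ENNReal.ofReal q) volume ≤
      (∫⁻ ξ, ENNReal.ofReal (3 * ‖ξ‖) * ‖γ ξ‖ₑ ^ 2) ^ (1 / 2 : ℝ) * (swK4 d) ^ (1 / 2 : ℝ) := by
  have hd' : (2 : ℝ) ≤ d := by exact_mod_cast hd
  have hd1 : (0 : ℝ) < (d : ℝ) - 1 := by linarith
  have hq0 : 0 < q := by rw [hq]; positivity
  rw [eLpNorm_eq_lintegral_rpow_enorm_toReal (by simpa using hq0) ENNReal.ofReal_ne_top,
    ENNReal.toReal_ofReal hq0.le]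
  have hcov : AECover (volume : Measure (SwE d)) Filter.atTop (fun n : ℕ => Metric.ball (0 : SwE d) n) :=
    aecover_ball tendsto_natCast_atTop_atTop
  have hm : AEMeasurable (fun p => ‖swEx γ p‖ₑ ^ q) (volume : Measure (SwE d)) :=
    ((swEx_cont hγ).enorm.measurable.pow_const _).aemeasurable
  have ht := hcov.lintegral_tendsto_of_countably_generated hm
  have ht2 := (ENNReal.continuous_rpow_const (y := 1 / q)).continuousAt.tendsto.comp ht
  exact le_of_tendsto' ht2 (fun n => sw_ball hd hq hγ n)

lemma sw_fourier_eq {d : ℕ} (f : SchwartzMap (EuclideanSpace ℝ (Fin d)) ℂ) :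
    ∃ h : SchwartzMap (EuclideanSpace ℝ (Fin d)) ℂ,
      ∀ ξ, fourierTf (fun x => f x) ξ = h ((2 * Real.pi)⁻¹ • ξ) := by
  refine ⟨FourierTransform.fourier f, fun ξ => ?_⟩
  rw [SchwartzMap.fourier_coe, Real.fourier_eq']
  unfold fourierTf
  congr 1; funext x
  rw [smul_eq_mul]
  congr 2
  rw [inner_smul_right]
  have hpi := Real.pi_ne_zero
  have : -2 * Real.pi * ((2 * Real.pi)⁻¹ * ⟪x, ξ⟫) = -⟪x, ξ⟫ := by field_simp
  rw [this]; push_cast; ring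

lemma sw_four_facts {d : ℕ} (hd : 2 ≤ d) (f : SchwartzMap (EuclideanSpace ℝ (Fin d)) ℂ) :
    Continuous (fourierTf (fun x => f x)) ∧ Integrable (fourierTf (fun x => f x)) ∧
    Integrable (fun ξ => ‖ξ‖ * ‖fourierTf (fun x => f x) ξ‖ ^ 2) ∧
    Integrable (fun ξ => ‖ξ‖⁻¹ * ‖fourierTf (fun x => f x) ξ‖) ∧
    Integrable (fun ξ => ‖ξ‖⁻¹ * ‖fourierTf (fun x => f x) ξ‖ ^ 2) := by
  obtain ⟨h, hh⟩ := sw_fourier_eq f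
  have hfun : fourierTf (fun x => f x) = fun ξ => h ((2 * Real.pi)⁻¹ • ξ) := funext hh
  set φ := fourierTf (fun x => f x) with hφ
  have hpi : (2 * Real.pi)⁻¹ ≠ 0 := by positivity
  have hc : Continuous φ := by
    rw [hfun]
    exact h.continuous.comp (continuous_const_smul _)
  have hI : Integrable φ := by
    rw [hfun]
    exact (integrable_comp_smul_iff volume (fun ξ => h ξ) hpi).2 h.integrable
  obtain ⟨B, hB⟩ : ∃ B : ℝ, ∀ ξ, ‖φ ξ‖ ≤ B := by
    obtain ⟨B, hB⟩ := h.decay 0 0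
    refine ⟨B, fun ξ => ?_⟩
    rw [hh]
    simpa using hB.2 ((2 * Real.pi)⁻¹ • ξ)
  have hB0 : 0 ≤ B := (norm_nonneg _).trans (hB 0)
  have h1 : Integrable (fun ξ => ‖ξ‖ * ‖φ ξ‖) := by
    have h0 := (integrable_comp_smul_iff volume (fun ξ => ‖ξ‖ ^ 1 * ‖h ξ‖) hpi).2 (h.integrable_pow_mul volume 1)
    refine (h0.const_mul (2 * Real.pi)).congr ?_
    filter_upwards with ξ
    rw [hh, norm_smul, pow_one, Real.norm_of_nonneg (by positivity)]
    have hpi := Real.pi_ne_zero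
    field_simp
  have hinv : Integrable (fun ξ => ‖ξ‖⁻¹ * ‖φ ξ‖) := by
    have hball : IntegrableOn (fun ξ : EuclideanSpace ℝ (Fin d) => B * ‖ξ‖⁻¹) (Metric.ball 0 1) := by
      refine integrableOn_ball_of_norm_le_rpow (C := B) (α := 1) ?_ ?_ ?_ ?_
      · simp; omega
      · simp; omega
      · filter_upwards with ξ
        rw [Real.norm_of_nonneg (by positivity), Real.rpow_neg_one]
      · fun_prop
    have hb2 := (integrable_indicator_iff measurableSet_ball).2 hball
    refine (hb2.add hI.norm).mono' ?_ ?_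
    · fun_prop
    · filter_upwards with ξ
      rw [Real.norm_of_nonneg (by positivity), Pi.add_apply]
      by_cases hξ : ξ ∈ Metric.ball (0 : EuclideanSpace ℝ (Fin d)) 1
      · rw [Set.indicator_of_mem hξ]
        have : ‖ξ‖⁻¹ * ‖φ ξ‖ ≤ B * ‖ξ‖⁻¹ := by
          rw [mul_comm]; gcongr; exact hB ξ
        linarith [norm_nonneg (φ ξ)]
      · rw [Set.indicator_of_notMem hξ, zero_add]
        have : 1 ≤ ‖ξ‖ := by simpa using hξ
        have : ‖ξ‖⁻¹ ≤ 1 := inv_le_one_of_one_le₀ this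
        nlinarith [norm_nonneg (φ ξ)]
  refine ⟨hc, hI, ?_, hinv, ?_⟩
  · refine (h1.const_mul B).mono' (by fun_prop) ?_
    filter_upwards with ξ
    rw [Real.norm_of_nonneg (by positivity)]
    calc ‖ξ‖ * ‖φ ξ‖ ^ 2 = ‖φ ξ‖ * (‖ξ‖ * ‖φ ξ‖) := by ring
      _ ≤ _ := by gcongr; exact hB ξ
  · refine (hinv.const_mul B).mono' (by fun_prop) ?_
    filter_upwards with ξ
    rw [Real.norm_of_nonneg (by positivity)]
    calc ‖ξ‖⁻¹ * ‖φ ξ‖ ^ 2 = ‖φ ξ‖ * (‖ξ‖⁻¹ * ‖φ ξ‖) := by ring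
      _ ≤ _ := by gcongr; exact hB ξ

lemma sw_gamma {d : ℕ} (hd : 2 ≤ d) (f g : SchwartzMap (EuclideanSpace ℝ (Fin d)) ℂ) (c : ℂ)
    (hc : ‖c‖ = 1) :
    Integrable (fun ξ => (1 / 2 : ℂ) * (fourierTf (fun x => f x) ξ +
      c * (fourierTf (fun x => g x) ξ / (I * (‖ξ‖ : ℂ))))) ∧
    (∫⁻ ξ, ENNReal.ofReal (3 * ‖ξ‖) * ‖(1 / 2 : ℂ) * (fourierTf (fun x => f x) ξ +
      c * (fourierTf (fun x => g x) ξ / (I * (‖ξ‖ : ℂ))))‖ₑ ^ 2) ^ (1 / 2 : ℝ) ≤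
      ENNReal.ofReal (2 * (sobolevNorm (1 / 2) (fun x => f x) + sobolevNorm (-(1 / 2)) (fun x => g x))) := by
  obtain ⟨fc, fI, fX, -, -⟩ := sw_four_facts hd f
  obtain ⟨gc, -, -, gI, gY⟩ := sw_four_facts hd g
  set φ := fourierTf (fun x => f x) with hφ
  set ψ := fourierTf (fun x => g x) with hψ
  have hnorm : ∀ ξ : EuclideanSpace ℝ (Fin d), ‖c * (ψ ξ / (I * (‖ξ‖ : ℂ)))‖ = ‖ξ‖⁻¹ * ‖ψ ξ‖ := by
    intro ξ
    rw [norm_mul, hc, one_mul, norm_div, norm_mul, norm_I, one_mul, norm_real, norm_norm, div_eq_inv_mul]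
  constructor
  · refine (fI.add ?_).const_mul _
    refine gI.mono' ?_ ?_
    · apply Measurable.aestronglyMeasurable
      have := gc.measurable
      fun_prop
    · filter_upwards with ξ
      exact (hnorm ξ).le
  set X := ∫ ξ, ‖ξ‖ * ‖φ ξ‖ ^ 2 with hX
  set Y := ∫ ξ, ‖ξ‖⁻¹ * ‖ψ ξ‖ ^ 2 with hY
  have hX0 : 0 ≤ X := integral_nonneg (fun _ => by positivity)
  have hY0 : 0 ≤ Y := integral_nonneg (fun _ => by positivity)
  have e1 : sobolevNorm (1 / 2) (fun x => f x) = X ^ (1 / 2 : ℝ) := by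
    unfold sobolevNorm
    rw [hX]
    congr 2; funext ξ
    rw [show (2 * (1 / 2) : ℝ) = 1 by norm_num, Real.rpow_one]
  have e2 : sobolevNorm (-(1 / 2)) (fun x => g x) = Y ^ (1 / 2 : ℝ) := by
    unfold sobolevNorm
    rw [hY]
    congr 2; funext ξ
    rw [show (2 * -(1 / 2) : ℝ) = -1 by norm_num, Real.rpow_neg_one]
  rw [e1, e2]
  have hA : ∫⁻ ξ, ENNReal.ofReal (3 * ‖ξ‖) * ‖(1 / 2 : ℂ) * (φ ξ + c * (ψ ξ / (I * (‖ξ‖ : ℂ))))‖ₑ ^ 2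
      ≤ ENNReal.ofReal (3 / 2 * (X + Y)) := by
    have hint : Integrable (fun ξ => 3 / 2 * (‖ξ‖ * ‖φ ξ‖ ^ 2 + ‖ξ‖⁻¹ * ‖ψ ξ‖ ^ 2)) :=
      (fX.add gY).const_mul _
    have e3 : 3 / 2 * (X + Y) = ∫ ξ, 3 / 2 * (‖ξ‖ * ‖φ ξ‖ ^ 2 + ‖ξ‖⁻¹ * ‖ψ ξ‖ ^ 2) := by
      rw [integral_const_mul, integral_add fX gY]
    rw [e3, ofReal_integral_eq_lintegral_ofReal hint (by filter_upwards with ξ; positivity)]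
    apply lintegral_mono
    intro ξ
    simp only
    rw [← ofReal_norm, ← ENNReal.ofReal_pow (norm_nonneg _), ← ENNReal.ofReal_mul (by positivity)]
    apply ENNReal.ofReal_le_ofReal
    by_cases hξ : ξ = 0
    · simp [hξ]
    have hr : 0 < ‖ξ‖ := norm_pos_iff.2 hξ
    have h1 : ‖(1 / 2 : ℂ) * (φ ξ + c * (ψ ξ / (I * (‖ξ‖ : ℂ))))‖ ≤ 1 / 2 * (‖φ ξ‖ + ‖ξ‖⁻¹ * ‖ψ ξ‖) := by
      rw [norm_mul, ← hnorm]
      have : ‖(1 / 2 : ℂ)‖ = 1 / 2 := by norm_num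
      rw [this]
      gcongr
      exact norm_add_le _ _
    have h2 : 3 / 2 * (‖ξ‖ * ‖φ ξ‖ ^ 2 + ‖ξ‖⁻¹ * ‖ψ ξ‖ ^ 2) =
        3 * ‖ξ‖ * (1 / 2 * (‖φ ξ‖ ^ 2 + (‖ξ‖⁻¹ * ‖ψ ξ‖) ^ 2)) := by field_simp
    rw [h2]
    gcongr
    calc _ ≤ (1 / 2 * (‖φ ξ‖ + ‖ξ‖⁻¹ * ‖ψ ξ‖)) ^ 2 := by gcongr
      _ ≤ _ := by nlinarith [sq_nonneg (‖φ ξ‖ - ‖ξ‖⁻¹ * ‖ψ ξ‖)]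
  calc _ ≤ ENNReal.ofReal (3 / 2 * (X + Y)) ^ (1 / 2 : ℝ) := by gcongr
    _ = ENNReal.ofReal ((3 / 2 * (X + Y)) ^ (1 / 2 : ℝ)) :=
        ENNReal.ofReal_rpow_of_nonneg (by positivity) (by norm_num)
    _ ≤ _ := by
        apply ENNReal.ofReal_le_ofReal
        rw [← Real.sqrt_eq_rpow, ← Real.sqrt_eq_rpow, ← Real.sqrt_eq_rpow]
        apply Real.sqrt_le_iff.2
        refine ⟨by positivity, ?_⟩
        have h1 := Real.sq_sqrt hX0
        have h2 := Real.sq_sqrt hY0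
        nlinarith [mul_nonneg (Real.sqrt_nonneg X) (Real.sqrt_nonneg Y)]

theorem strichartz_wave (d : ℕ) (hd : 2 ≤ d) :
    ∃ C : ℝ, 0 < C ∧ ∀ f g : SchwartzMap (EuclideanSpace ℝ (Fin d)) ℂ,
      eLpNorm (fun p : ℝ × EuclideanSpace ℝ (Fin d) =>
          (∫ ξ : EuclideanSpace ℝ (Fin d),
            Complex.exp (Complex.I * Complex.ofReal (p.1 * ‖ξ‖ + ⟪p.2, ξ⟫)) *
              ((1 / 2 : ℂ) * (fourierTf (fun x => f x) ξ +
                fourierTf (fun x => g x) ξ / (Complex.I * (‖ξ‖ : ℂ))))) +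
          ∫ ξ : EuclideanSpace ℝ (Fin d),
            Complex.exp (Complex.I * Complex.ofReal (-(p.1 * ‖ξ‖) + ⟪p.2, ξ⟫)) *
              ((1 / 2 : ℂ) * (fourierTf (fun x => f x) ξ -
                fourierTf (fun x => g x) ξ / (Complex.I * (‖ξ‖ : ℂ)))))
        (ENNReal.ofReal (2 * (d + 1) / (d - 1))) volume
      ≤ ENNReal.ofReal (C * (sobolevNorm (1 / 2) (fun x => f x) +
          sobolevNorm (-(1 / 2)) (fun x => g x))) := by
  have hd' : (2 : ℝ) ≤ d := by exact_mod_cast hd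
  have hCI := swCI_nonneg d
  set κ : ℝ := (4 * swCI d) ^ (1 / 2 : ℝ) with hκ
  have hκ0 : 0 ≤ κ := by positivity
  refine ⟨4 * κ + 1, by positivity, fun f g => ?_⟩
  set S := sobolevNorm (1 / 2) (fun x => f x) + sobolevNorm (-(1 / 2)) (fun x => g x) with hS
  have hS0 : 0 ≤ S := by
    have h1 : ∀ (s : ℝ) (h : EuclideanSpace ℝ (Fin d) → ℂ), 0 ≤ sobolevNorm s h := by
      intro s h
      unfold sobolevNorm
      exact Real.rpow_nonneg (integral_nonneg (fun _ => by positivity)) _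
    exact add_nonneg (h1 _ _) (h1 _ _)
  set q : ℝ := 2 * ((d : ℝ) + 1) / (d - 1) with hq
  obtain ⟨i1, b1⟩ := sw_gamma hd f g 1 (by simp)
  obtain ⟨i2, b2⟩ := sw_gamma hd f g (-1) (by simp)
  set γ1 : EuclideanSpace ℝ (Fin d) → ℂ := fun ξ => (1 / 2 : ℂ) * (fourierTf (fun x => f x) ξ +
      1 * (fourierTf (fun x => g x) ξ / (I * (‖ξ‖ : ℂ)))) with hγ1
  set γ2 : EuclideanSpace ℝ (Fin d) → ℂ := fun ξ => (1 / 2 : ℂ) * (fourierTf (fun x => f x) ξ +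
      (-1) * (fourierTf (fun x => g x) ξ / (I * (‖ξ‖ : ℂ)))) with hγ2
  have c1 := sw_ext hd hq i1
  have c2 := sw_ext hd hq i2
  have hK : (swK4 d) ^ (1 / 2 : ℝ) = ENNReal.ofReal κ := by
    unfold swK4
    rw [ENNReal.ofReal_rpow_of_nonneg (by positivity) (by norm_num)]
  rw [hK] at c1 c2
  have t1 : eLpNorm (swEx γ1) (ENNReal.ofReal q) volume ≤ ENNReal.ofReal (2 * S * κ) := by
    refine c1.trans ?_
    rw [ENNReal.ofReal_mul (by positivity)]
    gcongr
  have t2 : eLpNorm (swEx γ2) (ENNReal.ofReal q) volume ≤ ENNReal.ofReal (2 * S * κ) := by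
    refine c2.trans ?_
    rw [ENNReal.ofReal_mul (by positivity)]
    gcongr
  let ν : SwE d → SwE d := Prod.map (fun t : ℝ => -t) id
  have hν : MeasurePreserving ν volume volume :=
    (Measure.measurePreserving_neg (volume : Measure ℝ)).prod (MeasurePreserving.id volume)
  have hm1 := (swEx_cont i1).aestronglyMeasurable (μ := (volume : Measure (SwE d)))
  have hm2 := (swEx_cont i2).aestronglyMeasurable (μ := (volume : Measure (SwE d)))
  have t3 : eLpNorm (swEx γ2 ∘ ν) (ENNReal.ofReal q) volume ≤ ENNReal.ofReal (2 * S * κ) := by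
    rw [eLpNorm_comp_measurePreserving hm2 hν]
    exact t2
  have hq1 : 1 ≤ ENNReal.ofReal q := by
    rw [ENNReal.one_le_ofReal, hq, le_div_iff₀ (by linarith)]
    linarith
  have hsum := eLpNorm_add_le hm1 (hm2.comp_measurePreserving hν) hq1
  have hfun : (fun p : ℝ × EuclideanSpace ℝ (Fin d) =>
          (∫ ξ : EuclideanSpace ℝ (Fin d),
            Complex.exp (Complex.I * Complex.ofReal (p.1 * ‖ξ‖ + ⟪p.2, ξ⟫)) *
              ((1 / 2 : ℂ) * (fourierTf (fun x => f x) ξ +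
                fourierTf (fun x => g x) ξ / (Complex.I * (‖ξ‖ : ℂ))))) +
          ∫ ξ : EuclideanSpace ℝ (Fin d),
            Complex.exp (Complex.I * Complex.ofReal (-(p.1 * ‖ξ‖) + ⟪p.2, ξ⟫)) *
              ((1 / 2 : ℂ) * (fourierTf (fun x => f x) ξ -
                fourierTf (fun x => g x) ξ / (Complex.I * (‖ξ‖ : ℂ))))) = swEx γ1 + swEx γ2 ∘ ν := by
    funext p
    simp only [Pi.add_apply, Function.comp, swEx, swPr, ν, hγ1, hγ2, Prod.map_fst, Prod.map_snd, id,
      one_mul, neg_mul, ← sub_eq_add_neg]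
  rw [hfun]
  refine hsum.trans ((add_le_add t1 t3).trans ?_)
  rw [← ENNReal.ofReal_add (by positivity) (by positivity)]
  apply ENNReal.ofReal_le_ofReal
  nlinarith

end
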